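/- arXiv:2406.04868 — 3 statements merged into one kernel-verified Lean document; each statement's English description precedes it below -/
import Mathlib

section
/- (Utility for private pair-wise cosine similarities) Let V ∈ ℝ^{n×m} be a matrix whose rows v₁, …, v_n are unit vectors, let S := {X ∈ ℝ^{n×n} : X symmetric positive semidefinite, X_{ii} ≤ 1 for all i}, let ε, δ ∈ (0,1], Δ > 0, and let W ∈ ℝ^{n×n} be a random matrix with i.i.d. N(0, σ²) entries where σ² = 2·log(2/δ)·Δ²/ε². Then the matrix X̂ := Π_S(V·Vᵀ + W), the Frobenius-norm projection of V·Vᵀ + W onto S, satisfies E ‖V·Vᵀ − X̂‖_F² ≤ (16·√(log(2/δ))/(3ε))·Δ·n^{3/2}. (Note V·Vᵀ ∈ S, so Π_S(V·Vᵀ) = V·Vᵀ.) -/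
open MeasureTheory ProbabilityTheory Matrix

/-- Measure of an `n×n` random matrix with i.i.d. `N(0,v)` entries (on `Fin n → Fin n → ℝ`). -/
noncomputable def matGaussian (n : ℕ) (v : NNReal) : Measure (Fin n → Fin n → ℝ) :=
  Measure.pi fun _ : Fin n => Measure.pi fun _ : Fin n => gaussianReal 0 v

/-- Frobenius (trace) inner product `⟨A, B⟩ = ∑_{i,j} A_{ij}·B_{ij}`. -/
def frobInner {n : ℕ} (A B : Matrix (Fin n) (Fin n) ℝ) : ℝ :=
  ∑ i, ∑ j, A i j * B i j

/-- the quadratic form of the noise matrix. -/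
noncomputable def qf {n : ℕ} (w : Fin n → Fin n → ℝ) (u : EuclideanSpace ℝ (Fin n)) : ℝ :=
  ∑ i, ∑ j, w i j * (u i * u j)

lemma qf_cont {n : ℕ} (w : Fin n → Fin n → ℝ) : Continuous (qf w) := by
  unfold qf; fun_prop

lemma qf_neg {n : ℕ} (w : Fin n → Fin n → ℝ) (u : EuclideanSpace ℝ (Fin n)) :
    qf w (-u) = qf w u := by
  simp [qf]

lemma qf_par {n : ℕ} (w : Fin n → Fin n → ℝ) (x z : EuclideanSpace ℝ (Fin n)) :
    qf w x + qf w z = (qf w (x + z) + qf w (-x + z)) / 2 := by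
  simp only [qf, ← Finset.sum_add_distrib, Finset.sum_div]
  refine Finset.sum_congr rfl fun i _ => Finset.sum_congr rfl fun j _ => ?_
  simp only [PiLp.add_apply, PiLp.neg_apply]
  ring

lemma log_tangent (y a : ℝ) (ha : 0 < a) : y ≤ Real.exp y / a + (Real.log a - 1) := by
  have h := Real.add_one_le_exp (y - Real.log a)
  rw [Real.exp_sub, Real.exp_log ha] at h
  linarith

lemma transl_le {n : ℕ} (F : EuclideanSpace ℝ (Fin n) → ℝ) (hF : Continuous F) (h0 : ∀ u, 0 ≤ F u)
    (x : EuclideanSpace ℝ (Fin n)) (hx : ‖x‖ ≤ 1) :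
    ∫ z in Metric.closedBall 0 (1/4), F (x + z) ≤ ∫ u in Metric.closedBall 0 (5/4), F u := by
  have h := (measurePreserving_add_left (volume : Measure (EuclideanSpace ℝ (Fin n))) x
    ).setIntegral_preimage_emb (measurableEmbedding_addLeft x) F (Metric.closedBall x (1/4))
  have h2 : (fun z => x + z) ⁻¹' Metric.closedBall x (1/4) = Metric.closedBall 0 (1/4) := by
    ext z; simp [dist_eq_norm]
  rw [h2] at h
  rw [h]
  apply setIntegral_mono_set
  · exact hF.continuousOn.integrableOn_compact (isCompact_closedBall _ _)
  · exact Filter.Eventually.of_forall h0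
  · apply LE.le.eventuallyLE
    apply Metric.closedBall_subset_closedBall'
    rw [dist_zero_right]; linarith

lemma qf_bound {n : ℕ} (w : Fin n → Fin n → ℝ) (t a : ℝ) (ha : 0 < a)
    (x : EuclideanSpace ℝ (Fin n)) (hx : ‖x‖ ≤ 1) (v : ℝ)
    (hv : v = (volume : Measure (EuclideanSpace ℝ (Fin n))).real (Metric.closedBall 0 (1/4)))
    (hv0 : 0 < v) :
    t * qf w x ≤ 1 / (a * v) * (∫ u in Metric.closedBall 0 (5/4), Real.exp (t * qf w u))
      + (Real.log a - 1) - t * (1 / v * ∫ z in Metric.closedBall 0 (1/4), qf w z) := by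
  have hc := qf_cont w
  have hI : ∀ f : EuclideanSpace ℝ (Fin n) → ℝ, Continuous f →
      IntegrableOn f (Metric.closedBall 0 (1/4)) :=
    fun f hf => hf.continuousOn.integrableOn_compact (isCompact_closedBall _ _)
  have key : ∫ z in Metric.closedBall 0 (1/4), (t * qf w x + t * qf w z) ≤
      ∫ z in Metric.closedBall 0 (1/4), (1 / (2 * a) * Real.exp (t * qf w (x + z)) +
        1 / (2 * a) * Real.exp (t * qf w (-x + z)) + (Real.log a - 1)) := by
    apply setIntegral_mono
    · exact hI _ (by fun_prop)
    · exact hI _ (by fun_prop)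
    · intro z
      have h1 := log_tangent (t * qf w (x + z)) a ha
      have h2 := log_tangent (t * qf w (-x + z)) a ha
      have h3 := qf_par w x z
      have e : ∀ y : ℝ, 1 / (2 * a) * y = (y / a) / 2 := by intro y; field_simp
      simp only [e]
      rw [← mul_add, h3]
      linarith
  rw [integral_add (hI _ (by fun_prop)) (hI _ (by fun_prop)),
    integral_add (hI _ (by fun_prop)) (hI _ (by fun_prop)),
    integral_add (hI _ (by fun_prop)) (hI _ (by fun_prop))] at key
  simp only [integral_const_mul, setIntegral_const, ← hv, smul_eq_mul] at key
  have p1 := transl_le (fun u => Real.exp (t * qf w u)) (by fun_prop) (fun u => (Real.exp_pos _).le) x hx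
  have p2 := transl_le (fun u => Real.exp (t * qf w u)) (by fun_prop) (fun u => (Real.exp_pos _).le)
    (-x) (by simpa using hx)
  set I := ∫ u in Metric.closedBall 0 (5/4), Real.exp (t * qf w u)
  have q1 := mul_le_mul_of_nonneg_left p1 (by positivity : 0 ≤ 1 / (2 * a))
  have q2 := mul_le_mul_of_nonneg_left p2 (by positivity : 0 ≤ 1 / (2 * a))
  have key2 : v * (t * qf w x) ≤ v * (1 / (a * v) * I
      + (Real.log a - 1) - t * (1 / v * ∫ z in Metric.closedBall 0 (1/4), qf w z)) := by
    have e : v * (1 / (a * v) * I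
      + (Real.log a - 1) - t * (1 / v * ∫ z in Metric.closedBall 0 (1/4), qf w z)) =
      1 / (2 * a) * I + 1 / (2 * a) * I + v * (Real.log a - 1)
        - t * ∫ z in Metric.closedBall 0 (1/4), qf w z := by field_simp; ring
    rw [e]; linarith
  exact le_of_mul_le_mul_left key2 hv0

instance matGaussian_prob (n : ℕ) (s : NNReal) : IsProbabilityMeasure (matGaussian n s) := by
  unfold matGaussian; infer_instance

lemma mp_entry (n : ℕ) (s : NNReal) (i j : Fin n) :
    MeasurePreserving (fun w : Fin n → Fin n → ℝ => w i j) (matGaussian n s) (gaussianReal 0 s) :=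
  (measurePreserving_eval (fun _ : Fin n => gaussianReal 0 s) j).comp
    (measurePreserving_eval (fun _ : Fin n => Measure.pi fun _ : Fin n => gaussianReal 0 s) i)

lemma int_entry (n : ℕ) (s : NNReal) (i j : Fin n) :
    Integrable (fun w : Fin n → Fin n → ℝ => w i j) (matGaussian n s) := by
  have h : Integrable (fun x : ℝ => x) (gaussianReal 0 s) :=
    (memLp_id_gaussianReal 1).integrable (by simp)
  exact (mp_entry n s i j).integrable_comp_of_integrable h

lemma integral_entry (n : ℕ) (s : NNReal) (i j : Fin n) :
    ∫ w, w i j ∂(matGaussian n s) = 0 := by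
  have h := (mp_entry n s i j).map_eq
  have h2 : ∫ x, x ∂(gaussianReal 0 s) = 0 := by simp
  rw [← h, integral_map (mp_entry n s i j).aemeasurable (by fun_prop)] at h2
  exact h2

lemma int_lin (n : ℕ) (s : NNReal) (c : Fin n → Fin n → ℝ) :
    Integrable (fun w : Fin n → Fin n → ℝ => ∑ i, ∑ j, w i j * c i j) (matGaussian n s) :=
  integrable_finsetSum _ fun i _ => integrable_finsetSum _ fun j _ =>
    (int_entry n s i j).mul_const _

lemma integral_lin (n : ℕ) (s : NNReal) (c : Fin n → Fin n → ℝ) :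
    ∫ w : Fin n → Fin n → ℝ, ∑ i, ∑ j, w i j * c i j ∂(matGaussian n s) = 0 := by
  rw [integral_finsetSum _ fun i _ => integrable_finsetSum _ fun j _ =>
    (int_entry n s i j).mul_const _]
  refine Finset.sum_eq_zero fun i _ => ?_
  rw [integral_finsetSum _ fun j _ => (int_entry n s i j).mul_const _]
  refine Finset.sum_eq_zero fun j _ => ?_
  rw [integral_mul_const, integral_entry, zero_mul]

lemma exp_qf {n : ℕ} (w : Fin n → Fin n → ℝ) (t : ℝ) (u : EuclideanSpace ℝ (Fin n)) :
    Real.exp (t * qf w u) = ∏ i, ∏ j, Real.exp ((t * (u i * u j)) * w i j) := by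
  simp only [qf, Finset.mul_sum, Real.exp_sum]
  refine Finset.prod_congr rfl fun i _ => Finset.prod_congr rfl fun j _ => ?_
  congr 1; ring

lemma int_exp (n : ℕ) (s : NNReal) (t : ℝ) (u : EuclideanSpace ℝ (Fin n)) :
    Integrable (fun w => Real.exp (t * qf w u)) (matGaussian n s) := by
  simp only [exp_qf]
  unfold matGaussian
  refine Integrable.fintype_prod (f := fun i (y : Fin n → ℝ) =>
    ∏ j, Real.exp ((t * (u i * u j)) * y j)) fun i => ?_
  refine Integrable.fintype_prod (f := fun j (y : ℝ) =>
    Real.exp ((t * (u i * u j)) * y)) fun j => ?_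
  exact integrable_exp_mul_gaussianReal _

lemma integral_exp_qf (n : ℕ) (s : NNReal) (t : ℝ) (u : EuclideanSpace ℝ (Fin n)) :
    ∫ w, Real.exp (t * qf w u) ∂(matGaussian n s) = Real.exp (t ^ 2 * s * ‖u‖ ^ 4 / 2) := by
  simp only [exp_qf]
  unfold matGaussian
  rw [integral_fintype_prod_eq_prod (f := fun i (y : Fin n → ℝ) =>
    ∏ j, Real.exp ((t * (u i * u j)) * y j))]
  have : ∀ i, ∫ y : Fin n → ℝ, ∏ j, Real.exp ((t * (u i * u j)) * y j)
      ∂(Measure.pi fun _ : Fin n => gaussianReal 0 s) =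
      ∏ j, Real.exp (s * (t * (u i * u j)) ^ 2 / 2) := by
    intro i
    rw [integral_fintype_prod_eq_prod (f := fun j (y : ℝ) => Real.exp ((t * (u i * u j)) * y))]
    refine Finset.prod_congr rfl fun j _ => ?_
    have h := congrFun (mgf_id_gaussianReal (μ := 0) (v := s)) (t * (u i * u j))
    simpa [mgf] using h
  rw [Finset.prod_congr rfl fun i _ => this i]
  simp only [← Real.exp_sum]
  congr 1
  have hn : ‖u‖ ^ 4 = (∑ i, u i ^ 2) * ∑ j, u j ^ 2 := by
    rw [← EuclideanSpace.real_norm_sq_eq]; ring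
  rw [hn, Finset.sum_mul_sum, Finset.mul_sum, Finset.sum_div]
  refine Finset.sum_congr rfl fun i _ => ?_
  rw [Finset.mul_sum, Finset.sum_div]
  refine Finset.sum_congr rfl fun j _ => ?_
  ring

lemma int_prod (n : ℕ) (s : NNReal) (t : ℝ) :
    Integrable (Function.uncurry fun (w : Fin n → Fin n → ℝ) (u : EuclideanSpace ℝ (Fin n)) =>
      Real.exp (t * qf w u))
      ((matGaussian n s).prod (volume.restrict (Metric.closedBall 0 (5/4)))) := by
  have hm : Continuous (Function.uncurry fun (w : Fin n → Fin n → ℝ)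
      (u : EuclideanSpace ℝ (Fin n)) => Real.exp (t * qf w u)) := by
    unfold qf Function.uncurry; fun_prop
  rw [integrable_prod_iff' hm.aestronglyMeasurable]
  refine ⟨Filter.Eventually.of_forall fun u => int_exp n s t u, ?_⟩
  simp only [Function.uncurry, Real.norm_eq_abs, Real.abs_exp, integral_exp_qf]
  exact (Continuous.continuousOn (by fun_prop)).integrableOn_compact (isCompact_closedBall _ _)

lemma int_G (n : ℕ) (s : NNReal) (t : ℝ) :
    Integrable (fun w : Fin n → Fin n → ℝ => ∫ u in Metric.closedBall 0 (5/4),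
      Real.exp (t * qf w u)) (matGaussian n s) :=
  (int_prod n s t).integral_prod_left

lemma integral_G (n : ℕ) (s : NNReal) (t : ℝ) :
    ∫ w : Fin n → Fin n → ℝ, (∫ u in Metric.closedBall 0 (5/4),
      Real.exp (t * qf w u)) ∂(matGaussian n s) ≤
      Real.exp (t ^ 2 * s * (5/4) ^ 4 / 2) * (5 ^ n *
       (volume : Measure (EuclideanSpace ℝ (Fin n))).real (Metric.closedBall 0 (1/4))) := by
  rw [integral_integral_swap (int_prod n s t)]
  simp only [integral_exp_qf]
  have hvol : 5 ^ n * (volume : Measure (EuclideanSpace ℝ (Fin n))).real (Metric.closedBall 0 (1/4))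
      = (volume : Measure (EuclideanSpace ℝ (Fin n))).real (Metric.closedBall 0 (5/4)) := by
    rw [Measure.addHaar_real_closedBall _ _ (by norm_num),
      Measure.addHaar_real_closedBall _ _ (by norm_num), ← mul_assoc]
    simp only [finrank_euclideanSpace, Fintype.card_fin]
    rw [← mul_pow]; norm_num
  rw [hvol]
  calc _ ≤ ∫ u in (Metric.closedBall (0 : EuclideanSpace ℝ (Fin n)) (5/4)),
        Real.exp (t ^ 2 * s * (5/4) ^ 4 / 2) := by
        apply setIntegral_mono_on
        · exact (Continuous.continuousOn (by fun_prop)).integrableOn_compact (isCompact_closedBall _ _)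
        · exact (Continuous.continuousOn (by fun_prop)).integrableOn_compact (isCompact_closedBall _ _)
        · exact Metric.isClosed_closedBall.measurableSet
        · intro u hu
          have : ‖u‖ ≤ 5/4 := by simpa using hu
          gcongr
    _ = _ := by rw [setIntegral_const, smul_eq_mul, mul_comm]

open scoped MatrixOrder in
lemma psd_factor {n : ℕ} {Y : Matrix (Fin n) (Fin n) ℝ} (hY : Y.PosSemidef) :
    ∃ B : Matrix (Fin n) (Fin n) ℝ, Y = Bᴴ * B := by
  obtain ⟨B, hB⟩ := CStarAlgebra.nonneg_iff_eq_star_mul_self.mp hY.nonneg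
  exact ⟨B, hB⟩

lemma frob_le {n : ℕ} (w : Fin n → Fin n → ℝ) (R : ℝ)
    (hR : ∀ x : EuclideanSpace ℝ (Fin n), ‖x‖ ≤ 1 → qf w x ≤ R)
    (Y : Matrix (Fin n) (Fin n) ℝ) (hY : Y.PosSemidef) (hd : ∀ i, Y i i ≤ 1) :
    frobInner (Matrix.of w) Y ≤ n * R := by
  have hR0 : 0 ≤ R := by simpa [qf] using hR 0 (by simp)
  have hsc : ∀ x : EuclideanSpace ℝ (Fin n), qf w x ≤ ‖x‖ ^ 2 * R := by
    intro x
    rcases eq_or_ne x 0 with rfl | hx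
    · simp [qf]
    have hx' : 0 < ‖x‖ := norm_pos_iff.mpr hx
    have h := hR (‖x‖⁻¹ • x) (by rw [norm_smul, norm_inv, norm_norm, inv_mul_cancel₀ hx'.ne'])
    have e : qf w x = ‖x‖ ^ 2 * qf w (‖x‖⁻¹ • x) := by
      simp only [qf, Finset.mul_sum]
      refine Finset.sum_congr rfl fun i _ => Finset.sum_congr rfl fun j _ => ?_
      simp only [PiLp.smul_apply, smul_eq_mul]
      field_simp
    rw [e]; gcongr
  obtain ⟨B, hB⟩ := psd_factor hY
  have hYe : ∀ i j, Y i j = ∑ k, B k i * B k j := by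
    intro i j; rw [hB]; simp [Matrix.mul_apply]
  have e1 : frobInner (Matrix.of w) Y = ∑ k, qf w (WithLp.toLp 2 (B k)) := by
    simp only [frobInner, qf, hYe, Matrix.of_apply, Finset.mul_sum]
    symm
    rw [Finset.sum_comm]
    refine Finset.sum_congr rfl fun i _ => ?_
    rw [Finset.sum_comm]
  have e2 : ∑ k, ‖(WithLp.toLp 2 (B k) : EuclideanSpace ℝ (Fin n))‖ ^ 2 = ∑ i, Y i i := by
    simp only [EuclideanSpace.real_norm_sq_eq, hYe]
    rw [Finset.sum_comm]
    simp [sq]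
  rw [e1]
  calc _ ≤ ∑ k, ‖(WithLp.toLp 2 (B k) : EuclideanSpace ℝ (Fin n))‖ ^ 2 * R :=
        Finset.sum_le_sum fun k _ => hsc _
    _ = (∑ i, Y i i) * R := by rw [← Finset.sum_mul, e2]
    _ ≤ n * R := by
        gcongr
        calc _ ≤ ∑ i : Fin n, (1 : ℝ) := Finset.sum_le_sum fun i _ => hd i
          _ = n := by simp

lemma frob_expand {n : ℕ} (A D : Matrix (Fin n) (Fin n) ℝ) (s : ℝ) :
    frobInner (A - s • D) (A - s • D) =
      frobInner A A - 2 * s * frobInner A D + s ^ 2 * frobInner D D := by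
  simp only [frobInner, Finset.mul_sum, ← Finset.sum_add_distrib, ← Finset.sum_sub_distrib]
  refine Finset.sum_congr rfl fun i _ => Finset.sum_congr rfl fun j _ => ?_
  simp only [Matrix.sub_apply, Matrix.smul_apply, smul_eq_mul]
  ring

lemma frob_nonneg {n : ℕ} (A : Matrix (Fin n) (Fin n) ℝ) : 0 ≤ frobInner A A :=
  Finset.sum_nonneg fun _ _ => Finset.sum_nonneg fun _ _ => mul_self_nonneg _

lemma proj_ineq {n : ℕ} (S : Set (Matrix (Fin n) (Fin n) ℝ)) (hS : Convex ℝ S)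
    (X P W : Matrix (Fin n) (Fin n) ℝ) (hX : X ∈ S) (hP : P ∈ S)
    (h : ∀ Y ∈ S, frobInner (X + W - P) (X + W - P) ≤ frobInner (X + W - Y) (X + W - Y)) :
    frobInner (X - P) (X - P) ≤ frobInner W P - frobInner W X := by
  have h1 : frobInner (X + W - P) (X - P) ≤ 0 := by
    by_contra! hc
    set A := X + W - P
    set D := X - P
    have hD := frob_nonneg D
    have h2 : ∀ s : ℝ, 0 < s → s ≤ 1 → 2 * frobInner A D ≤ s * frobInner D D := by
      intro s h0 h1
      have hm : P + s • D ∈ S := hS.add_smul_sub_mem hP hX ⟨h0.le, h1⟩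
      have h3 := h _ hm
      have e : X + W - (P + s • D) = A - s • D := by simp only [A]; abel
      rw [e, frob_expand] at h3
      have : s * (2 * frobInner A D) ≤ s * (s * frobInner D D) := by nlinarith
      exact le_of_mul_le_mul_left this h0
    rcases le_or_gt (frobInner D D) (frobInner A D) with hle | hlt
    · have := h2 1 one_pos le_rfl
      linarith
    · have hpos : 0 < frobInner D D := hc.trans hlt
      have := h2 (frobInner A D / frobInner D D) (by positivity) ((div_le_one hpos).mpr hlt.le)
      rw [div_mul_cancel₀ _ hpos.ne'] at this
      linarith
  have e : frobInner (X + W - P) (X - P) =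
      frobInner (X - P) (X - P) - (frobInner W P - frobInner W X) := by
    simp only [frobInner, ← Finset.sum_sub_distrib]
    refine Finset.sum_congr rfl fun i _ => Finset.sum_congr rfl fun j _ => ?_
    simp only [Matrix.sub_apply, Matrix.add_apply]
    ring
  linarith

lemma convS (n : ℕ) :
    Convex ℝ {X : Matrix (Fin n) (Fin n) ℝ | X.PosSemidef ∧ ∀ i, X i i ≤ 1} := by
  intro X hX Y hY a b ha hb hab
  refine ⟨(hX.1.smul ha).add (hY.1.smul hb), fun i => ?_⟩
  simp only [Matrix.add_apply, Matrix.smul_apply, smul_eq_mul]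
  nlinarith [hX.2 i, hY.2 i]

/-- Utility for private pair-wise cosine similarities:
if the rows of `V ∈ ℝ^{n×m}` are unit vectors, `S = {X PSD, X_{ii} ≤ 1}`,
`W` has i.i.d. `N(0,σ²)` entries with `σ² = 2·log(2/δ)·Δ²/ε²`, and
`X̂ = Π_S(V·Vᵀ + W)` (Frobenius-norm projection), then
`E ‖V·Vᵀ − X̂‖_F² ≤ (16√(log(2/δ))/(3ε))·Δ·n^{3/2}`. -/
theorem private_cosine_similarity_utility
    (n m : ℕ) (V : Matrix (Fin n) (Fin m) ℝ)
    (hrows : ∀ i, ∑ j, V i j ^ 2 = 1)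
    (S : Set (Matrix (Fin n) (Fin n) ℝ))
    (hS : S = {X : Matrix (Fin n) (Fin n) ℝ | X.PosSemidef ∧ ∀ i, X i i ≤ 1})
    (proj : Matrix (Fin n) (Fin n) ℝ → Matrix (Fin n) (Fin n) ℝ)
    (hproj : ∀ M, proj M ∈ S ∧
      ∀ Y ∈ S, frobInner (M - proj M) (M - proj M) ≤ frobInner (M - Y) (M - Y))
    (ε δ Δ : ℝ) (hε : ε ∈ Set.Ioc (0 : ℝ) 1) (hδ : δ ∈ Set.Ioc (0 : ℝ) 1) (hΔ : 0 < Δ)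
    (σ2 : NNReal) (hσ2 : (σ2 : ℝ) = 2 * Real.log (2 / δ) * Δ ^ 2 / ε ^ 2) :
    ∫ w, frobInner (V * Vᵀ - proj (V * Vᵀ + Matrix.of w))
          (V * Vᵀ - proj (V * Vᵀ + Matrix.of w)) ∂(matGaussian n σ2)
      ≤ 16 * Real.sqrt (Real.log (2 / δ)) / (3 * ε) * Δ * (n : ℝ) ^ ((3 : ℝ) / 2) := by
  subst hS
  rcases Nat.eq_zero_or_pos n with hn | hn
  · subst hn
    simp [frobInner]
  obtain ⟨hε0, hε1⟩ := hε
  obtain ⟨hδ0, hδ1⟩ := hδ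
  have hL : 0 < Real.log (2 / δ) := by
    apply Real.log_pos
    rw [lt_div_iff₀ hδ0]; linarith
  set L := Real.log (2 / δ)
  have hX : V * Vᵀ ∈ {X : Matrix (Fin n) (Fin n) ℝ | X.PosSemidef ∧ ∀ i, X i i ≤ 1} := by
    refine ⟨by simpa using Matrix.posSemidef_self_mul_conjTranspose V, fun i => ?_⟩
    rw [Matrix.mul_apply]
    have := hrows i
    simp only [Matrix.transpose_apply, ← sq]
    exact this.le
  set X := V * Vᵀ
  have hn' : (0 : ℝ) < n := by exact_mod_cast hn
  set σ : ℝ := Real.sqrt 2 * Real.sqrt L * Δ / ε with hσ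
  have hσ0 : 0 < σ := by positivity
  have hσsq : (σ2 : ℝ) = σ ^ 2 := by
    rw [hσ2, hσ, div_pow, mul_pow, mul_pow, Real.sq_sqrt (by norm_num), Real.sq_sqrt hL.le]
  set t : ℝ := Real.sqrt n / σ with ht
  have ht0 : 0 < t := by positivity
  have hts : t ^ 2 * σ2 = n := by
    rw [hσsq, ht, div_pow, Real.sq_sqrt hn'.le]; field_simp
  set v := (volume : Measure (EuclideanSpace ℝ (Fin n))).real (Metric.closedBall 0 (1/4)) with hv
  have hv0 : 0 < v := by
    rw [hv, Measure.addHaar_real_closedBall _ _ (by norm_num)]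
    have : 0 < (volume : Measure (EuclideanSpace ℝ (Fin n))).real (Metric.ball 0 1) :=
      ENNReal.toReal_pos (Metric.measure_ball_pos _ _ one_pos).ne' measure_ball_lt_top.ne
    positivity
  set b := Real.exp (t ^ 2 * σ2 * (5/4) ^ 4 / 2) with hb
  set a := b * 5 ^ n with ha
  have ha0 : 0 < a := by positivity
  set c : Fin n → Fin n → ℝ := fun i j =>
    1 / v * ∫ z in Metric.closedBall (0 : EuclideanSpace ℝ (Fin n)) (1/4), z i * z j with hc
  have hq : ∀ w : Fin n → Fin n → ℝ,
      1 / v * ∫ z in Metric.closedBall 0 (1/4), qf w z = ∑ i, ∑ j, w i j * c i j := by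
    intro w
    have hI : ∀ f : EuclideanSpace ℝ (Fin n) → ℝ, Continuous f →
        IntegrableOn f (Metric.closedBall 0 (1/4)) :=
      fun f hf => hf.continuousOn.integrableOn_compact (isCompact_closedBall _ _)
    unfold qf
    rw [integral_finsetSum _ fun i _ => hI _ (by fun_prop), Finset.mul_sum]
    refine Finset.sum_congr rfl fun i _ => ?_
    rw [integral_finsetSum _ fun j _ => hI _ (by fun_prop), Finset.mul_sum]
    refine Finset.sum_congr rfl fun j _ => ?_
    rw [integral_const_mul]; simp only [hc]; ring
  set G : (Fin n → Fin n → ℝ) → ℝ := fun w =>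
    ∫ u in Metric.closedBall 0 (5/4), Real.exp (t * qf w u) with hG
  set R : (Fin n → Fin n → ℝ) → ℝ := fun w =>
    1 / t * (1 / (a * v) * G w + (Real.log a - 1)) - ∑ i, ∑ j, w i j * c i j with hRdef
  have hR : ∀ w, ∀ x : EuclideanSpace ℝ (Fin n), ‖x‖ ≤ 1 → qf w x ≤ R w := by
    intro w x hx
    have h := qf_bound w t a ha0 x hx v hv hv0
    rw [hq w] at h
    refine le_of_mul_le_mul_left ?_ ht0
    have e : t * R w = 1 / (a * v) * G w + (Real.log a - 1) - t * ∑ i, ∑ j, w i j * c i j := by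
      simp only [hRdef]; field_simp
    rw [e]; exact h
  have hGint : Integrable G (matGaussian n σ2) := int_G n σ2 t
  have hA : Integrable (fun w => 1 / t * (1 / (a * v) * G w + (Real.log a - 1)))
      (matGaussian n σ2) := ((hGint.const_mul _).add (integrable_const _)).const_mul _
  have hRint : Integrable R (matGaussian n σ2) := hA.sub (int_lin n σ2 c)
  have hXint : Integrable (fun w => frobInner (Matrix.of w) X) (matGaussian n σ2) :=
    int_lin n σ2 X
  have hX0 : ∫ w, frobInner (Matrix.of w) X ∂(matGaussian n σ2) = 0 := integral_lin n σ2 X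
  have hloga : Real.log a ≤ (n : ℝ) * (13/4) := by
    rw [ha, Real.log_mul (by positivity) (by positivity), hb, Real.log_exp, Real.log_pow, hts]
    have h5 : Real.log 5 ≤ 2 := by
      rw [Real.log_le_iff_le_exp (by norm_num)]
      have := Real.exp_one_gt_d9
      have e : Real.exp 2 = Real.exp 1 ^ 2 := by rw [← Real.exp_nat_mul]; norm_num
      rw [e]; nlinarith
    nlinarith
  have hRI : ∫ w, R w ∂(matGaussian n σ2) ≤ 1 / t * ((n : ℝ) * (13/4)) := by
    simp only [hRdef]
    rw [integral_sub hA (int_lin n σ2 c), integral_lin, sub_zero, integral_const_mul,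
      integral_add (hGint.const_mul _) (integrable_const _), integral_const_mul, integral_const]
    simp only [probReal_univ, one_smul]
    have hGI : ∫ w, G w ∂(matGaussian n σ2) ≤ a * v := by
      have := integral_G n σ2 t
      rw [ha, mul_assoc]; exact this
    have : 1 / (a * v) * ∫ w, G w ∂(matGaussian n σ2) ≤ 1 := by
      rw [one_div_mul_eq_div, div_le_one (by positivity)]; exact hGI
    gcongr
    linarith
  calc _ ≤ ∫ w, (n * R w - frobInner (Matrix.of w) X) ∂(matGaussian n σ2) := by
        apply integral_mono_of_nonneg
        · exact Filter.Eventually.of_forall fun w => frob_nonneg _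
        · exact (hRint.const_mul _).sub hXint
        · refine Filter.Eventually.of_forall fun w => ?_
          obtain ⟨h1, h2⟩ := hproj (X + Matrix.of w)
          have h3 := proj_ineq _ (convS n) X _ (Matrix.of w) hX h1 h2
          have h4 := frob_le w (R w) (hR w) _ h1.1 h1.2
          simp only
          linarith
    _ = n * ∫ w, R w ∂(matGaussian n σ2) := by
        rw [integral_sub (hRint.const_mul _) hXint, hX0, sub_zero, integral_const_mul]
    _ ≤ n * (1 / t * ((n : ℝ) * (13/4))) := by gcongr
    _ = (13/4 * Real.sqrt 2) * (Real.sqrt L / ε * Δ * (n * Real.sqrt n)) := by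
        rw [ht, hσ]
        have : Real.sqrt n * Real.sqrt n = n := Real.mul_self_sqrt hn'.le
        have hs : 0 < Real.sqrt n := by positivity
        field_simp
        rw [sq, this]
    _ ≤ (16/3) * (Real.sqrt L / ε * Δ * (n * Real.sqrt n)) := by
        gcongr
        have : Real.sqrt 2 ≤ 1.5 := by
          rw [Real.sqrt_le_left (by norm_num)]; norm_num
        linarith
    _ = _ := by
        have : (n : ℝ) ^ ((3 : ℝ) / 2) = n * Real.sqrt n := by
          rw [show (3 : ℝ) / 2 = 1 + 1 / 2 by norm_num, Real.rpow_add hn', Real.rpow_one,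
            ← Real.sqrt_eq_rpow]
        rw [this]
        field_simp
end

section
/- (Utility for sparse k-way marginals, odd case) There is an absolute constant C > 0 such that the following holds for all n ≥ 2, odd k ≥ 3, 1 ≤ t ≤ n, ε, δ ∈ (0,1] and m ≥ 1. Let e₁, …, e_m ∈ {0,1}ⁿ be binary vectors each with at most t nonzero entries, let T* := (1/m)·∑_{i=1}^m (e_i/√t)^{⊗k}, let S_{4k−4,n} := { Ẽ_μ[x^{⊗k}] : μ is a degree-(4k−4) pseudo-distribution on ℝ^{3n} satisfying P_t }, and let W ∈ (ℝⁿ)^{⊗k} be a random tensor with i.i.d. N(0, σ²) entries where σ = 2·√(log(2/δ))/(ε·m). Then the projection T̂ := Π_{S_{4k−4,n}}(T* + W) of T* + W onto S_{4k−4,n} in Euclidean (Frobenius) norm satisfies E ‖T̂ − T*‖² ≤ C·(√(log(2/δ))/(ε·m))·t^{k/2}·√(k·log n). -/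
open MeasureTheory ProbabilityTheory

/-- Pseudo-expectation `Ẽ_μ[f] = ∑_w μ(w)·f(w)` of a polynomial `f` with respect to a
finitely supported function `μ`. -/
noncomputable def pExp {σ : Type*} (μ : (σ → ℝ) →₀ ℝ) (f : MvPolynomial σ ℝ) : ℝ :=
  μ.sum fun w c => c * MvPolynomial.eval w f

/-- A polynomial is a sum of squares. -/
def IsSOSPoly {σ : Type*} (p : MvPolynomial σ ℝ) : Prop :=
  ∃ (r : ℕ) (q : Fin r → MvPolynomial σ ℝ), p = ∑ i, q i ^ 2

/-- `μ` is a degree-`ℓ` pseudo-distribution: it is finitely supported, has total mass `1`,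
and `Ẽ_μ[f²] ≥ 0` for every polynomial `f` of degree at most `ℓ/2`. -/
def IsPseudoDist {σ : Type*} (ℓ : ℕ) (μ : (σ → ℝ) →₀ ℝ) : Prop :=
  (μ.sum fun _ c => c) = 1 ∧
    ∀ f : MvPolynomial σ ℝ, 2 * f.totalDegree ≤ ℓ → 0 ≤ pExp μ (f ^ 2)

/-- `μ` satisfies the system `{g i ≥ 0}` at degree `ℓ`: for every subset `T` of the
constraints and every sum-of-squares `h` with `deg(h·∏_{i∈T} g i) ≤ ℓ`,
`Ẽ_μ[h·∏_{i∈T} g i] ≥ 0`. -/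
def SatisfiesSystem {σ ι : Type*} (ℓ : ℕ) (μ : (σ → ℝ) →₀ ℝ)
    (g : ι → MvPolynomial σ ℝ) : Prop :=
  ∀ (T : Finset ι) (h : MvPolynomial σ ℝ), IsSOSPoly h →
    (h * ∏ i ∈ T, g i).totalDegree ≤ ℓ →
      0 ≤ pExp μ (h * ∏ i ∈ T, g i)

/-- Index set of the constraints of the system `P_t` (in variables `x, s, y ∈ ℝⁿ`,
encoded on `Fin 3 × Fin n` with `x i = X (0,i)`, `s i = X (1,i)`, `y i = X (2,i)`). -/
inductive PtIdx (n : ℕ) where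
  | normUB
  | boolLB (i : Fin n)
  | boolUB (i : Fin n)
  | suppLB (i : Fin n)
  | suppUB (i : Fin n)
  | sparsity
  | absPos (i : Fin n)
  | absNeg (i : Fin n)
  | sqLB (i : Fin n)
  | sqUB (i : Fin n)

/-- The system `P_t` of polynomial constraints (each polynomial is constrained to be `≥ 0`;
equalities are encoded by two opposite inequalities): `‖x‖² ≤ 1`; `s_i² = s_i`;
`x_i·s_i = x_i`; `∑ s_i ≤ t`; `x_i ≤ y_i`; `−x_i ≤ y_i`; `x_i² = y_i²`. -/
noncomputable def PtSys (n : ℕ) (t : ℝ) : PtIdx n → MvPolynomial (Fin 3 × Fin n) ℝ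
  | .normUB => MvPolynomial.C 1 - ∑ i : Fin n, MvPolynomial.X (0, i) ^ 2
  | .boolLB i => MvPolynomial.X (1, i) - MvPolynomial.X (1, i) ^ 2
  | .boolUB i => MvPolynomial.X (1, i) ^ 2 - MvPolynomial.X (1, i)
  | .suppLB i => MvPolynomial.X (0, i) - MvPolynomial.X (0, i) * MvPolynomial.X (1, i)
  | .suppUB i => MvPolynomial.X (0, i) * MvPolynomial.X (1, i) - MvPolynomial.X (0, i)
  | .sparsity => MvPolynomial.C t - ∑ i : Fin n, MvPolynomial.X (1, i)
  | .absPos i => MvPolynomial.X (2, i) - MvPolynomial.X (0, i)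
  | .absNeg i => MvPolynomial.X (2, i) + MvPolynomial.X (0, i)
  | .sqLB i => MvPolynomial.X (0, i) ^ 2 - MvPolynomial.X (2, i) ^ 2
  | .sqUB i => MvPolynomial.X (2, i) ^ 2 - MvPolynomial.X (0, i) ^ 2

/-- The set `S_{4k−4,n}` of `k`-th moment tensors `Ẽ_μ[x^{⊗k}]` of degree-`(4k−4)`
pseudo-distributions satisfying `P_t`. -/
noncomputable def momentSet (n k : ℕ) (t : ℝ) : Set ((Fin k → Fin n) → ℝ) :=
  {X | ∃ μ : (Fin 3 × Fin n → ℝ) →₀ ℝ,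
    IsPseudoDist (4 * k - 4) μ ∧ SatisfiesSystem (4 * k - 4) μ (PtSys n t) ∧
    ∀ α : Fin k → Fin n, X α = pExp μ (∏ j, MvPolynomial.X (0, α j))}


section Cone

/-- Generators of the truncated preordering at degree `d`. -/
def coneGen {σ ι : Type*} (g : ι → MvPolynomial σ ℝ) (d : ℕ) : Set (MvPolynomial σ ℝ) :=
  {p | (∃ (h : MvPolynomial σ ℝ) (T : Finset ι), p = h ^ 2 * ∏ i ∈ T, g i) ∧ p.totalDegree ≤ d}

/-- The truncated preordering at degree `d`. -/
noncomputable def cone {σ ι : Type*} (g : ι → MvPolynomial σ ℝ) (d : ℕ) :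
    AddSubmonoid (MvPolynomial σ ℝ) :=
  AddSubmonoid.closure (coneGen g d)

variable {σ ι : Type*} {g : ι → MvPolynomial σ ℝ}

lemma pExp_add (μ : (σ → ℝ) →₀ ℝ) (p q : MvPolynomial σ ℝ) :
    pExp μ (p + q) = pExp μ p + pExp μ q := by
  simp [pExp, Finsupp.sum, mul_add, Finset.sum_add_distrib]

lemma pExp_sub (μ : (σ → ℝ) →₀ ℝ) (p q : MvPolynomial σ ℝ) :
    pExp μ (p - q) = pExp μ p - pExp μ q := by
  simp [pExp, Finsupp.sum, mul_sub, Finset.sum_sub_distrib]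

lemma pExp_sum {κ : Type*} (μ : (σ → ℝ) →₀ ℝ) (s : Finset κ) (p : κ → MvPolynomial σ ℝ) :
    pExp μ (∑ i ∈ s, p i) = ∑ i ∈ s, pExp μ (p i) := by
  simp only [pExp, Finsupp.sum, map_sum, Finset.mul_sum]
  rw [Finset.sum_comm]

lemma pExp_C (μ : (σ → ℝ) →₀ ℝ) (h : (μ.sum fun _ c => c) = 1) (c : ℝ) :
    pExp μ (MvPolynomial.C c) = c := by
  simp only [pExp, MvPolynomial.eval_C]
  simp only [Finsupp.sum] at *
  rw [← Finset.sum_mul, h, one_mul]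

lemma cone_nonneg {ℓ d : ℕ} {μ : (σ → ℝ) →₀ ℝ} (hμ : SatisfiesSystem ℓ μ g) (hd : d ≤ ℓ)
    {p : MvPolynomial σ ℝ} (hp : p ∈ cone g d) : 0 ≤ pExp μ p := by
  induction hp using AddSubmonoid.closure_induction with
  | mem x hx =>
    obtain ⟨⟨h, T, rfl⟩, hdeg⟩ := hx
    exact hμ T (h ^ 2) ⟨1, fun _ => h, by simp⟩ (hdeg.trans hd)
  | zero => simp [pExp]
  | add x y _ _ hx hy => rw [pExp_add]; exact add_nonneg hx hy

lemma cone_mono {d d' : ℕ} (h : d ≤ d') {p : MvPolynomial σ ℝ} (hp : p ∈ cone g d) :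
    p ∈ cone g d' :=
  AddSubmonoid.closure_mono (fun x (hx : x ∈ coneGen g d) => (⟨hx.1, hx.2.trans h⟩ : x ∈ coneGen g d')) hp

lemma cone_mul {d d' : ℕ} {p q : MvPolynomial σ ℝ} (hp : p ∈ cone g d) (hq : q ∈ cone g d') :
    p * q ∈ cone g (d + d') := by
  classical
  induction hp using AddSubmonoid.closure_induction with
  | zero => simp
  | add x y _ _ hx hy => rw [add_mul]; exact AddSubmonoid.add_mem _ hx hy
  | mem x hx =>
    induction hq using AddSubmonoid.closure_induction with
    | zero => simp
    | add y z _ _ hy hz => rw [mul_add]; exact AddSubmonoid.add_mem _ hy hz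
    | mem y hy =>
      apply AddSubmonoid.subset_closure
      refine ⟨?_, (MvPolynomial.totalDegree_mul _ _).trans (add_le_add hx.2 hy.2)⟩
      obtain ⟨⟨h, T, rfl⟩, -⟩ := hx
      obtain ⟨⟨h', T', rfl⟩, -⟩ := hy
      refine ⟨h * h' * ∏ i ∈ T ∩ T', g i, (T \ T') ∪ (T' \ T), ?_⟩
      rw [Finset.prod_union (by
        rw [Finset.disjoint_left]; intro a; simp; tauto)]
      have h1 : ∏ i ∈ T, g i = (∏ i ∈ T ∩ T', g i) * ∏ i ∈ T \ T', g i :=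
        (Finset.prod_inter_mul_prod_sdiff T T' g).symm
      have h2 : ∏ i ∈ T', g i = (∏ i ∈ T ∩ T', g i) * ∏ i ∈ T' \ T, g i := by
        rw [Finset.inter_comm]; exact (Finset.prod_inter_mul_prod_sdiff T' T g).symm
      rw [h1, h2]; ring

lemma cone_sq {d : ℕ} (h : MvPolynomial σ ℝ) (hd : h.totalDegree ≤ d) : h ^ 2 ∈ cone g (2 * d) := by
  apply AddSubmonoid.subset_closure
  refine ⟨⟨h, ∅, by simp⟩, (MvPolynomial.totalDegree_pow _ _).trans (by omega)⟩

lemma cone_gen {d : ℕ} (i : ι) (hd : (g i).totalDegree ≤ d) : g i ∈ cone g d := by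
  apply AddSubmonoid.subset_closure
  exact ⟨⟨1, {i}, by simp⟩, hd⟩

lemma cone_C {c : ℝ} (hc : 0 ≤ c) : MvPolynomial.C c ∈ cone g 0 := by
  have := cone_sq (g := g) (d := 0) (MvPolynomial.C (Real.sqrt c)) (by simp)
  rwa [← map_pow, Real.sq_sqrt hc] at this

lemma cone_smul {d : ℕ} {c : ℝ} (hc : 0 ≤ c) {p : MvPolynomial σ ℝ} (hp : p ∈ cone g d) :
    MvPolynomial.C c * p ∈ cone g d := by
  have := cone_mul (cone_C (g := g) hc) hp
  rwa [zero_add] at this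

lemma cone_pow {d : ℕ} {p : MvPolynomial σ ℝ} (hp : p ∈ cone g d) (j : ℕ) :
    p ^ j ∈ cone g (j * d) := by
  induction j with
  | zero => simpa using cone_C (g := g) (σ := σ) (c := 1) zero_le_one
  | succ j ih => rw [pow_succ, add_mul, one_mul]; exact cone_mul ih hp

lemma cone_prod_pm {κ : Type*} (s : Finset κ) (x y : κ → MvPolynomial σ ℝ)
    (ha : ∀ j, y j + x j ∈ cone g 1) (hb : ∀ j, y j - x j ∈ cone g 1) :
    (∏ j ∈ s, y j) + (∏ j ∈ s, x j) ∈ cone g s.card ∧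
    (∏ j ∈ s, y j) - (∏ j ∈ s, x j) ∈ cone g s.card := by
  classical
  induction s using Finset.induction_on with
  | empty =>
    constructor
    · have := cone_C (g := g) (σ := σ) (c := 2) (by norm_num)
      have e : (MvPolynomial.C 2 : MvPolynomial σ ℝ) = 1 + 1 := by
        rw [← one_add_one_eq_two, map_add, map_one]
      simpa [e] using this
    · simp
  | insert j s hj ih =>
    rw [Finset.prod_insert hj, Finset.prod_insert hj, Finset.card_insert_of_notMem hj, add_comm s.card]
    obtain ⟨h1, h2⟩ := ih
    have hh : (MvPolynomial.C (1/2) : MvPolynomial σ ℝ) * 2 = 1 := by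
      have : (2 : MvPolynomial σ ℝ) = MvPolynomial.C 2 := (map_ofNat MvPolynomial.C 2).symm
      rw [this, ← map_mul]; norm_num
    set P := ∏ j ∈ s, y j
    set Q := ∏ j ∈ s, x j
    constructor
    · have := cone_smul (c := 1/2) (by norm_num) (add_mem (cone_mul (ha j) h1) (cone_mul (hb j) h2))
      convert this using 1
      linear_combination (-(y j * P + x j * Q)) * hh
    · have := cone_smul (c := 1/2) (by norm_num) (add_mem (cone_mul (ha j) h2) (cone_mul (hb j) h1))
      convert this using 1
      linear_combination (-(y j * P - x j * Q)) * hh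

end Cone

section Pt

open MvPolynomial

lemma td_sub {σ : Type*} {p q : MvPolynomial σ ℝ} {d : ℕ} (hp : p.totalDegree ≤ d)
    (hq : q.totalDegree ≤ d) : (p - q).totalDegree ≤ d :=
  (totalDegree_sub _ _).trans (max_le hp hq)

lemma td_add {σ : Type*} {p q : MvPolynomial σ ℝ} {d : ℕ} (hp : p.totalDegree ≤ d)
    (hq : q.totalDegree ≤ d) : (p + q).totalDegree ≤ d :=
  (totalDegree_add _ _).trans (max_le hp hq)

lemma td_mul {σ : Type*} {p q : MvPolynomial σ ℝ} {d e f : ℕ} (hp : p.totalDegree ≤ d)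
    (hq : q.totalDegree ≤ e) (h : d + e ≤ f) : (p * q).totalDegree ≤ f :=
  (totalDegree_mul _ _).trans ((add_le_add hp hq).trans h)

lemma td_X {σ : Type*} (i : σ) {d : ℕ} (h : 1 ≤ d) : (X i : MvPolynomial σ ℝ).totalDegree ≤ d := by
  rw [totalDegree_X]; exact h

lemma td_X2 {σ : Type*} (i : σ) : (X i ^ 2 : MvPolynomial σ ℝ).totalDegree ≤ 2 := by
  rw [pow_two]; exact td_mul (td_X i le_rfl) (td_X i le_rfl) le_rfl

lemma td_C {σ : Type*} (c : ℝ) {d : ℕ} : (C c : MvPolynomial σ ℝ).totalDegree ≤ d := by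
  simp

variable {n : ℕ} {t : ℝ}

lemma mem_normUB : C 1 - ∑ i : Fin n, X (0, i) ^ 2 ∈ cone (PtSys n t) 2 :=
  cone_gen (g := PtSys n t) .normUB
    (td_sub (td_C _) (totalDegree_finsetSum_le fun _ _ => td_X2 _))

lemma mem_boolLB (i : Fin n) : X (1, i) - X (1, i) ^ 2 ∈ cone (PtSys n t) 2 :=
  cone_gen (g := PtSys n t) (.boolLB i) (td_sub (td_X _ (by norm_num)) (td_X2 _))

lemma mem_suppLB (i : Fin n) : X (0, i) - X (0, i) * X (1, i) ∈ cone (PtSys n t) 2 :=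
  cone_gen (g := PtSys n t) (.suppLB i)
    (td_sub (td_X _ (by norm_num)) (td_mul (td_X _ le_rfl) (td_X _ le_rfl) le_rfl))

lemma mem_suppUB (i : Fin n) : X (0, i) * X (1, i) - X (0, i) ∈ cone (PtSys n t) 2 :=
  cone_gen (g := PtSys n t) (.suppUB i)
    (td_sub (td_mul (td_X _ le_rfl) (td_X _ le_rfl) le_rfl) (td_X _ (by norm_num)))

lemma mem_sparsity : C t - ∑ i : Fin n, X (1, i) ∈ cone (PtSys n t) 1 :=
  cone_gen (g := PtSys n t) .sparsity
    (td_sub (td_C _) (totalDegree_finsetSum_le fun _ _ => td_X _ le_rfl))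

lemma mem_absPos (i : Fin n) : X (2, i) - X (0, i) ∈ cone (PtSys n t) 1 :=
  cone_gen (g := PtSys n t) (.absPos i) (td_sub (td_X _ le_rfl) (td_X _ le_rfl))

lemma mem_absNeg (i : Fin n) : X (2, i) + X (0, i) ∈ cone (PtSys n t) 1 :=
  cone_gen (g := PtSys n t) (.absNeg i) (td_add (td_X _ le_rfl) (td_X _ le_rfl))

lemma mem_sqLB (i : Fin n) : X (0, i) ^ 2 - X (2, i) ^ 2 ∈ cone (PtSys n t) 2 :=
  cone_gen (g := PtSys n t) (.sqLB i) (td_sub (td_X2 _) (td_X2 _))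

lemma C_half_mul_two {σ : Type*} : (C (1/2) : MvPolynomial σ ℝ) * 2 = 1 := by
  have : (2 : MvPolynomial σ ℝ) = MvPolynomial.C 2 := (map_ofNat MvPolynomial.C 2).symm
  rw [this, ← map_mul]; norm_num

lemma mem_y (i : Fin n) : X (2, i) ∈ cone (PtSys n t) 1 := by
  have := cone_smul (c := 1/2) (by norm_num)
    (add_mem (mem_absPos (t := t) i) (mem_absNeg (t := t) i))
  convert this using 1
  linear_combination (-X (2, i)) * C_half_mul_two

lemma mem_neg_q_sq (i : Fin n) : -(X (2, i) * (1 - X (1, i))) ^ 2 ∈ cone (PtSys n t) 4 := by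
  have h1 : (1 - X (1, i)) ^ 2 * (X (0, i) ^ 2 - X (2, i) ^ 2) ∈ cone (PtSys n t) 4 :=
    cone_mono (d := 2 * 1 + 2) (by norm_num)
      (cone_mul (cone_sq (d := 1) _ (td_sub (by simp) (td_X _ le_rfl))) (mem_sqLB i))
  have h2 : X (0, i) ^ 2 * (X (1, i) - X (1, i) ^ 2) ∈ cone (PtSys n t) 4 :=
    cone_mono (d := 2 * 1 + 2) (by norm_num)
      (cone_mul (cone_sq (d := 1) _ (td_X _ le_rfl)) (mem_boolLB i))
  have h3 := cone_smul (c := 1/2) (by norm_num)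
    (add_mem (cone_mul (mem_absNeg (t := t) i) (mem_suppUB (t := t) i))
      (cone_mul (mem_absPos (t := t) i) (mem_suppLB (t := t) i)))
  have h4 := cone_mono (d' := 4) (by norm_num) h3
  convert add_mem (add_mem h1 h2) h4 using 1
  linear_combination (-(X (0, i) ^ 2 * (X (1, i) - 1))) * C_half_mul_two

lemma mem_eta_sub (i : Fin n) {η : ℝ} (hη : 0 < η) :
    C η - X (2, i) * (1 - X (1, i)) ∈ cone (PtSys n t) 4 := by
  have h1 : (C (2 * η) - X (2, i) * (1 - X (1, i))) ^ 2 ∈ cone (PtSys n t) 4 :=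
    cone_sq (d := 2) _ (td_sub (td_C _)
      (td_mul (td_X _ le_rfl) (td_sub (by simp) (td_X _ le_rfl)) le_rfl))
  convert cone_smul (c := 1 / (4 * η)) (by positivity) (add_mem h1 (mem_neg_q_sq i)) using 1
  have e1 : (C (1 / (4 * η)) : MvPolynomial (Fin 3 × Fin n) ℝ) * C (2 * η) ^ 2 = C η := by
    rw [← map_pow, ← map_mul]; congr 1; field_simp; norm_num
  have e2 : (C (1 / (4 * η)) : MvPolynomial (Fin 3 × Fin n) ℝ) * C (2 * η) * 2 = 1 := by
    have : (2 : MvPolynomial (Fin 3 × Fin n) ℝ) = MvPolynomial.C 2 :=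
      (map_ofNat MvPolynomial.C 2).symm
    rw [this, ← map_mul, ← map_mul, ← map_one C]; congr 1; field_simp; norm_num
  linear_combination -e1 + X (2, i) * (1 - X (1, i)) * e2

lemma mem_u : ∑ i : Fin n, X (2, i) ∈ cone (PtSys n t) 1 :=
  sum_mem fun i _ => mem_y i

lemma mem_M_sub_u (ht : 0 < t) {η : ℝ} (hη : 0 < η) :
    C (Real.sqrt t + n * η) - ∑ i : Fin n, X (2, i) ∈ cone (PtSys n t) 4 := by
  set r := Real.sqrt t with hr
  have hr0 : 0 < r := Real.sqrt_pos.mpr ht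
  have hrt : r * r = t := Real.mul_self_sqrt ht.le
  have hA : 0 ≤ r / 2 := by positivity
  have hD : 0 ≤ 1 / (2 * r) := by positivity
  have hterm : ∀ i : Fin n, C (r / 2) * X (0, i) ^ 2 + C (1 / (2 * r)) * X (1, i)
      - X (2, i) + C η ∈ cone (PtSys n t) 4 := by
    intro i
    have h1 := cone_mono (d' := 4) (by norm_num) (cone_smul hA (mem_sqLB (t := t) i))
    have h2 := cone_mono (d' := 4) (by norm_num) (cone_smul hD (mem_boolLB (t := t) i))
    have h3 := cone_mono (d' := 4) (by norm_num) (cone_smul hA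
      (cone_sq (g := PtSys n t) (d := 1) (X (2, i) - C (1 / r) * X (1, i))
        (td_sub (td_X _ le_rfl) (td_mul (td_C _ (d := 0)) (td_X _ le_rfl) (by norm_num)))))
    have h4 := mem_eta_sub (t := t) i hη
    convert add_mem (add_mem h1 h2) (add_mem h3 h4) using 1
    have e1 : (C (r / 2) : MvPolynomial (Fin 3 × Fin n) ℝ) * C (1 / r) * 2 = 1 := by
      have : (2 : MvPolynomial (Fin 3 × Fin n) ℝ) = MvPolynomial.C 2 :=
        (map_ofNat MvPolynomial.C 2).symm
      rw [this, ← map_mul, ← map_mul, ← map_one C]; congr 1; field_simp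
    have e2 : (C (r / 2) : MvPolynomial (Fin 3 × Fin n) ℝ) * C (1 / r) ^ 2 = C (1 / (2 * r)) := by
      rw [← map_pow, ← map_mul]; congr 1; field_simp
    linear_combination X (2, i) * X (1, i) * e1 - X (1, i) ^ 2 * e2
  have hs := sum_mem (S := cone (PtSys n t) 4) (t := Finset.univ) fun i _ => hterm i
  have h1 := cone_mono (d' := 4) (by norm_num) (cone_smul hA (mem_normUB (n := n) (t := t)))
  have h2 := cone_mono (d' := 4) (by norm_num) (cone_smul hD (mem_sparsity (n := n) (t := t)))
  convert add_mem (add_mem h1 h2) hs using 1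
  simp only [Finset.sum_add_distrib, Finset.sum_sub_distrib, ← Finset.mul_sum, Finset.sum_const,
    Finset.card_univ, Fintype.card_fin, nsmul_eq_mul]
  have e3 : (C (1 / (2 * r)) : MvPolynomial (Fin 3 × Fin n) ℝ) * C t = C (r / 2) := by
    rw [← map_mul]; congr 1; rw [← hrt]; field_simp
  have e4 : (C (r + n * η) : MvPolynomial (Fin 3 × Fin n) ℝ)
      = C (r / 2) + C (r / 2) + (n : MvPolynomial (Fin 3 × Fin n) ℝ) * C η := by
    rw [← map_natCast (C : ℝ →+* MvPolynomial (Fin 3 × Fin n) ℝ), ← map_mul, ← map_add, ← map_add]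
    congr 1; ring
  rw [e4, map_one]
  linear_combination -e3

lemma mem_pow_sub (ht : 0 < t) {η : ℝ} (hη : 0 < η) (k : ℕ) :
    C (Real.sqrt t + n * η) ^ k - (∑ i : Fin n, X (2, i)) ^ k ∈ cone (PtSys n t) (k + 3) := by
  rw [← (Commute.all _ _).mul_geom_sum₂, Finset.mul_sum]
  refine sum_mem fun i hi => ?_
  have hi := Finset.mem_range.mp hi
  have h1 := cone_mul (cone_pow (cone_C (g := PtSys n t)
    (show 0 ≤ Real.sqrt t + n * η by positivity)) i) (cone_pow (mem_u (n := n) (t := t)) (k - 1 - i))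
  exact cone_mono (by omega) (cone_mul (mem_M_sub_u ht hη) h1)

lemma l1_bound {k : ℕ} (hk : 3 ≤ k) (hn : 2 ≤ n) (ht : 1 ≤ t) {Y : (Fin k → Fin n) → ℝ}
    (hY : Y ∈ momentSet n k t) :
    ∑ α, |Y α| ≤ Real.exp 1 * t ^ ((k : ℝ) / 2) := by
  obtain ⟨μ, hμ1, hμ2, hY⟩ := hY
  have ht0 : 0 < t := by linarith
  have hr0 : 0 < Real.sqrt t := Real.sqrt_pos.mpr ht0
  have hk0 : (0 : ℝ) < k := by exact_mod_cast (by omega : 0 < k)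
  have hn0 : (0 : ℝ) < n := by exact_mod_cast (by omega : 0 < n)
  have step1 : ∀ α, |Y α| ≤ pExp μ (∏ j, X (2, α j)) := by
    intro α
    have := cone_prod_pm (g := PtSys n t) (Finset.univ : Finset (Fin k)) (fun j => X (0, α j))
      (fun j => X (2, α j)) (fun j => mem_absNeg _) (fun j => mem_absPos _)
    simp only [Finset.card_univ, Fintype.card_fin] at this
    have h1 := cone_nonneg hμ2 (by omega) this.1
    have h2 := cone_nonneg hμ2 (by omega) this.2
    rw [pExp_add] at h1
    rw [pExp_sub] at h2
    rw [hY, abs_le]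
    constructor <;> linarith
  have step2 : ∑ α : Fin k → Fin n, pExp μ (∏ j, X (2, α j))
      = pExp μ ((∑ i : Fin n, X (2, i)) ^ k) := by
    rw [← pExp_sum]
    congr 1
    have := Finset.prod_univ_sum (fun _ : Fin k => (Finset.univ : Finset (Fin n)))
      (fun _ i => (X (2, i) : MvPolynomial (Fin 3 × Fin n) ℝ))
    simpa using this.symm
  set η := Real.sqrt t / (k * n) with hη
  have step3 := cone_nonneg hμ2 (by omega) (mem_pow_sub (n := n) ht0 (η := η) (by positivity) k)
  rw [pExp_sub, ← map_pow, pExp_C _ hμ1.1] at step3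
  have hM : Real.sqrt t + n * η = Real.sqrt t * (1 + 1 / k) := by
    rw [hη]; field_simp
  have hpow : Real.sqrt t ^ k = t ^ ((k : ℝ) / 2) := by
    rw [Real.sqrt_eq_rpow, ← Real.rpow_natCast, ← Real.rpow_mul ht0.le]
    congr 1; ring
  have hexp : (1 + 1 / (k : ℝ)) ^ k ≤ Real.exp 1 := by
    have h1 : 1 + 1 / (k : ℝ) ≤ Real.exp (1 / k) := by
      have := Real.add_one_le_exp (1 / (k : ℝ)); linarith
    calc (1 + 1 / (k : ℝ)) ^ k ≤ Real.exp (1 / k) ^ k := pow_le_pow_left₀ (by positivity) h1 k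
      _ = Real.exp 1 := by rw [← Real.exp_nat_mul]; congr 1; field_simp
  rw [hM, mul_pow, hpow] at step3
  calc ∑ α, |Y α| ≤ ∑ α : Fin k → Fin n, pExp μ (∏ j, X (2, α j)) :=
        Finset.sum_le_sum fun α _ => step1 α
    _ ≤ t ^ ((k : ℝ) / 2) * (1 + 1 / (k : ℝ)) ^ k := by rw [step2]; linarith
    _ ≤ t ^ ((k : ℝ) / 2) * Real.exp 1 := by gcongr
    _ = _ := mul_comm _ _

lemma Tstar_mem {k m : ℕ} (ht : 1 ≤ t) (hm : 1 ≤ m) (e : Fin m → Fin n → ℝ)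
    (he : ∀ i j, e i j = 0 ∨ e i j = 1)
    (hs : ∀ i, ((Finset.univ.filter fun j => e i j ≠ 0).card : ℝ) ≤ t)
    (T : (Fin k → Fin n) → ℝ)
    (hT : ∀ α, T α = (1 / (m : ℝ)) * ∑ i, ∏ j, (e i (α j) / Real.sqrt t)) :
    T ∈ momentSet n k t := by
  have ht0 : 0 < t := by linarith
  have hr0 : 0 < Real.sqrt t := Real.sqrt_pos.mpr ht0
  have hm0 : (0 : ℝ) < m := by exact_mod_cast (by omega : 0 < m)
  have hsum : ∀ i, ∑ j, e i j ≤ t := by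
    intro i
    refine le_trans (le_of_eq ?_) (hs i)
    rw [Finset.card_filter]
    push_cast
    refine Finset.sum_congr rfl fun j _ => ?_
    rcases he i j with h | h <;> simp [h]
  have hsq : ∀ i j, e i j ^ 2 = e i j := by
    intro i j; rcases he i j with h | h <;> simp [h]
  have hnn : ∀ i j, 0 ≤ e i j := by
    intro i j; rcases he i j with h | h <;> simp [h]
  let pt : Fin m → (Fin 3 × Fin n → ℝ) := fun i p =>
    if p.1 = 1 then e i p.2 else e i p.2 / Real.sqrt t
  let μ : (Fin 3 × Fin n → ℝ) →₀ ℝ := ∑ i, Finsupp.single (pt i) (1 / (m : ℝ))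
  have hgen : ∀ F : (Fin 3 × Fin n → ℝ) → ℝ,
      (μ.sum fun w c => c * F w) = (1 / (m : ℝ)) * ∑ i, F (pt i) := by
    intro F
    rw [← Finsupp.sum_finsetSum_index (by simp) (by intros; ring), Finset.mul_sum]
    refine Finset.sum_congr rfl fun i _ => ?_
    rw [Finsupp.sum_single_index (by simp)]
  have hE : ∀ f, pExp μ f = (1 / (m : ℝ)) * ∑ i, MvPolynomial.eval (pt i) f := fun f => hgen _
  have h20 : ¬ ((2 : Fin 3) = 1) := by decide
  have hg : ∀ i c, 0 ≤ MvPolynomial.eval (pt i) (PtSys n t c) := by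
    intro i c
    cases c with
    | normUB =>
      simp only [PtSys, map_sub, map_sum, map_pow, eval_X, eval_C, pt]
      simp only [zero_ne_one, if_false, div_pow, hsq, Real.sq_sqrt ht0.le, ← Finset.sum_div]
      rw [sub_nonneg, div_le_one ht0]; exact hsum i
    | boolLB j => simp [PtSys, pt, hsq]
    | boolUB j => simp [PtSys, pt, hsq]
    | suppLB j => 
      rcases he i j with h | h <;> simp [PtSys, pt, h]
    | suppUB j => 
      rcases he i j with h | h <;> simp [PtSys, pt, h]
    | sparsity => simpa [PtSys, pt] using hsum i
    | absPos j => simp [PtSys, pt, h20]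
    | absNeg j =>
      have := hnn i j
      simp only [PtSys, pt, map_add, eval_X, h20, zero_ne_one, if_false]
      positivity
    | sqLB j => simp [PtSys, pt, h20]
    | sqUB j => simp [PtSys, pt, h20]
  refine ⟨μ, ⟨?_, ?_⟩, ?_, ?_⟩
  · have := hgen fun _ => 1
    simp only [mul_one] at this
    rw [this]; simp; field_simp
  · intro f _
    rw [hE]
    refine mul_nonneg (by positivity) (Finset.sum_nonneg fun i _ => ?_)
    rw [map_pow]; positivity
  · intro S h hh _
    rw [hE]
    refine mul_nonneg (by positivity) (Finset.sum_nonneg fun i _ => ?_)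
    rw [map_mul, map_prod]
    refine mul_nonneg ?_ (Finset.prod_nonneg fun c _ => hg i c)
    obtain ⟨r, q, rfl⟩ := hh
    rw [map_sum]
    refine Finset.sum_nonneg fun j _ => ?_
    rw [map_pow]; positivity
  · intro α
    rw [hT, hE]
    simp [map_prod, pt]

end Pt

section Gauss

open Real

/-- A smooth upper bound for the maximum of `|w α|`. -/
noncomputable def maxBound {ι : Type*} [Fintype ι] (lam A : ℝ) (w : ι → ℝ) : ℝ :=
  (log A - 1 + (∑ α, (exp (lam * w α) + exp (-lam * w α))) / A) / lam

lemma abs_le_maxBound {ι : Type*} [Fintype ι] {lam A : ℝ} (hl : 0 < lam) (hA : 0 < A) (w : ι → ℝ)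
    (α : ι) : |w α| ≤ maxBound lam A w := by
  rw [maxBound, le_div_iff₀ hl]
  have h1 : exp (lam * |w α|) ≤ ∑ α, (exp (lam * w α) + exp (-lam * w α)) := by
    have h2 : exp (lam * |w α|) ≤ exp (lam * w α) + exp (-lam * w α) := by
      rcases abs_cases (w α) with ⟨h, _⟩ | ⟨h, _⟩
      · rw [h]; linarith [exp_pos (-lam * w α)]
      · rw [h, mul_neg, ← neg_mul]; linarith [exp_pos (lam * w α)]
    exact h2.trans (Finset.single_le_sum (f := fun α => exp (lam * w α) + exp (-lam * w α))
      (fun _ _ => by positivity) (Finset.mem_univ α))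
  have h3 := add_one_le_exp (lam * |w α| - log A)
  rw [exp_sub, exp_log hA] at h3
  have h4 : exp (lam * |w α|) / A ≤ (∑ α, (exp (lam * w α) + exp (-lam * w α))) / A := by gcongr
  linarith

lemma integrable_exp_eval {ι : Type*} [Fintype ι] (v : NNReal) (lam : ℝ) (α : ι) :
    Integrable (fun w : ι → ℝ => exp (lam * w α)) (Measure.pi fun _ : ι => gaussianReal 0 v) :=
  integrable_comp_eval (μ := fun _ : ι => gaussianReal 0 v) (i := α)
    (integrable_exp_mul_gaussianReal lam)

lemma integral_exp_eval {ι : Type*} [Fintype ι] (v : NNReal) (lam : ℝ) (α : ι) :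
    ∫ w : ι → ℝ, exp (lam * w α) ∂(Measure.pi fun _ : ι => gaussianReal 0 v)
      = exp (v * lam ^ 2 / 2) := by
  have h := integral_comp_eval (μ := fun _ : ι => gaussianReal 0 v) (i := α)
    (integrable_exp_mul_gaussianReal (μ := 0) (v := v) lam).aestronglyMeasurable
  rw [h]
  have := congrFun (mgf_id_gaussianReal (μ := 0) (v := v)) lam
  simpa [mgf] using this

lemma integrable_maxBound {ι : Type*} [Fintype ι] (v : NNReal) (lam A : ℝ) :
    Integrable (maxBound (ι := ι) lam A) (Measure.pi fun _ : ι => gaussianReal 0 v) := by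
  unfold maxBound
  refine Integrable.div_const (Integrable.add (integrable_const _) (Integrable.div_const ?_ _)) _
  exact integrable_finsetSum _ fun α _ =>
    (integrable_exp_eval v lam α).add (integrable_exp_eval v (-lam) α)

lemma integral_maxBound {ι : Type*} [Fintype ι] (v : NNReal) (lam A : ℝ) :
    ∫ w, maxBound (ι := ι) lam A w ∂(Measure.pi fun _ : ι => gaussianReal 0 v)
      = (log A - 1 + (2 * Fintype.card ι * exp (v * lam ^ 2 / 2)) / A) / lam := by
  have hi : ∀ α : ι, Integrable (fun w : ι → ℝ => exp (lam * w α) + exp (-lam * w α))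
      (Measure.pi fun _ : ι => gaussianReal 0 v) := fun α =>
    (integrable_exp_eval v lam α).add (integrable_exp_eval v (-lam) α)
  have hS : Integrable (fun w : ι → ℝ => (∑ α, (exp (lam * w α) + exp (-lam * w α))) / A)
      (Measure.pi fun _ : ι => gaussianReal 0 v) :=
    Integrable.div_const (integrable_finsetSum _ fun α _ => hi α) _
  unfold maxBound
  rw [integral_div, integral_add (integrable_const _) hS, integral_div,
    integral_finsetSum _ fun α _ => hi α]
  simp_rw [integral_add (integrable_exp_eval v lam _) (integrable_exp_eval v (-lam) _),
    integral_exp_eval]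
  simp
  ring_nf

lemma exists_maxBound {n k : ℕ} (hn : 2 ≤ n) (hk : 3 ≤ k) (v : NNReal) {s : ℝ} (hs : 0 < s)
    (hv : (v : ℝ) = s ^ 2) :
    ∃ G : ((Fin k → Fin n) → ℝ) → ℝ,
      (∀ w α, |w α| ≤ G w) ∧
      Integrable G (Measure.pi fun _ : Fin k → Fin n => gaussianReal 0 v) ∧
      ∫ w, G w ∂(Measure.pi fun _ : Fin k → Fin n => gaussianReal 0 v)
        ≤ 2 * s * sqrt (k * log n) := by
  have hn0 : (0 : ℝ) < n := by exact_mod_cast (by omega : 0 < n)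
  have hk0 : (0 : ℝ) < k := by exact_mod_cast (by omega : 0 < k)
  have hln : log 2 ≤ log n := log_le_log (by norm_num) (by exact_mod_cast hn)
  have hl2 : 0 < log 2 := log_pos (by norm_num)
  set q := sqrt (k * log n) with hq
  have hq2 : q ^ 2 = k * log n := sq_sqrt (by nlinarith)
  have hq0 : 0 < q := sqrt_pos.mpr (mul_pos hk0 (by linarith))
  set lam := 2 * q / s with hlam
  have hlam0 : 0 < lam := by positivity
  have hvl : (v : ℝ) * lam ^ 2 / 2 = 2 * q ^ 2 := by
    rw [hv, hlam]; field_simp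
  set A := 2 * (n : ℝ) ^ k * exp (2 * q ^ 2) with hA
  have hA0 : 0 < A := by positivity
  refine ⟨maxBound lam A, abs_le_maxBound hlam0 hA0, integrable_maxBound v lam A, ?_⟩
  rw [integral_maxBound, hvl]
  have hcard : (Fintype.card (Fin k → Fin n) : ℝ) = (n : ℝ) ^ k := by simp
  rw [hcard, ← hA, div_self hA0.ne', div_le_iff₀ hlam0]
  have hlogA : log A = log 2 + k * log n + 2 * q ^ 2 := by
    rw [hA, log_mul (by positivity) (by positivity), log_mul (by norm_num) (by positivity),
      log_pow, log_exp]
  have hk1 : log n ≤ k * log n := by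
    have : (1 : ℝ) ≤ k := by exact_mod_cast (by omega : 1 ≤ k)
    nlinarith
  have : 2 * s * q * lam = 4 * q ^ 2 := by rw [hlam]; field_simp; norm_num
  rw [this, hlogA]
  nlinarith

end Gauss

/-- Utility for sparse k-way marginals, odd case: there is an absolute
constant `C > 0` such that for all `n ≥ 2`, odd `k ≥ 3`, `1 ≤ t ≤ n`, `ε, δ ∈ (0,1]`,
`m ≥ 1`, binary `t`-sparse vectors `e₁,…,e_m`, `T* = (1/m)∑(eᵢ/√t)^{⊗k}`, and
`W` with i.i.d. `N(0,σ²)` entries, `σ = 2√(log(2/δ))/(ε·m)`, the Euclidean projection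
`T̂ = Π_{S_{4k−4,n}}(T* + W)` satisfies
`E ‖T̂ − T*‖² ≤ C·(√(log(2/δ))/(ε·m))·t^{k/2}·√(k·log n)`. -/
theorem sparse_kway_marginals_utility_odd :
    ∃ C : ℝ, 0 < C ∧
      ∀ (n k m : ℕ) (t ε δ : ℝ) (e : Fin m → Fin n → ℝ)
        (Tstar : (Fin k → Fin n) → ℝ)
        (proj : ((Fin k → Fin n) → ℝ) → ((Fin k → Fin n) → ℝ))
        (σ2 : NNReal),
        2 ≤ n → 3 ≤ k → Odd k → 1 ≤ t → t ≤ n →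
        ε ∈ Set.Ioc (0 : ℝ) 1 → δ ∈ Set.Ioc (0 : ℝ) 1 → 1 ≤ m →
        (∀ i j, e i j = 0 ∨ e i j = 1) →
        (∀ i, ((Finset.univ.filter fun j => e i j ≠ 0).card : ℝ) ≤ t) →
        (∀ α, Tstar α = (1 / (m : ℝ)) * ∑ i, ∏ j, (e i (α j) / Real.sqrt t)) →
        (∀ A, proj A ∈ momentSet n k t ∧
          ∀ Y ∈ momentSet n k t,
            ∑ α, (A α - proj A α) ^ 2 ≤ ∑ α, (A α - Y α) ^ 2) →
        (σ2 : ℝ) = (2 * Real.sqrt (Real.log (2 / δ)) / (ε * m)) ^ 2 →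
        ∫ w, (∑ α, (proj (Tstar + w) α - Tstar α) ^ 2)
            ∂(Measure.pi fun _ : Fin k → Fin n => gaussianReal 0 σ2)
          ≤ C * (Real.sqrt (Real.log (2 / δ)) / (ε * m)) * t ^ ((k : ℝ) / 2)
              * Real.sqrt (k * Real.log n) := by
  refine ⟨16 * Real.exp 1, by positivity, ?_⟩
  intro n k m t ε δ e Tstar proj σ2 hn hk _ ht _ hε hδ hm he hes hT hproj hσ
  have hm0 : (0 : ℝ) < m := by exact_mod_cast (by omega : 0 < m)
  have hε0 : 0 < ε := hε.1
  have hlog : 0 < Real.log (2 / δ) := by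
    apply Real.log_pos
    rw [lt_div_iff₀ hδ.1]
    linarith [hδ.2]
  have hL : 0 < Real.sqrt (Real.log (2 / δ)) := Real.sqrt_pos.mpr hlog
  obtain ⟨G, hG1, hG2, hG3⟩ := exists_maxBound (n := n) (k := k) hn hk σ2
    (s := 2 * Real.sqrt (Real.log (2 / δ)) / (ε * m)) (by positivity) hσ
  have hTm : Tstar ∈ momentSet n k t := Tstar_mem ht hm e he hes Tstar hT
  set B := Real.exp 1 * t ^ ((k : ℝ) / 2) with hB
  have hB0 : 0 ≤ B := by positivity
  have key : ∀ w, ∑ α, (proj (Tstar + w) α - Tstar α) ^ 2 ≤ 4 * B * G w := by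
    intro w
    obtain ⟨hP, hmin⟩ := hproj (Tstar + w)
    have h1 := hmin Tstar hTm
    set P := proj (Tstar + w)
    have h2 : ∑ α, (P α - Tstar α) ^ 2 ≤ ∑ α, 2 * (w α * (P α - Tstar α)) := by
      have e1 : ∑ α, ((Tstar + w) α - P α) ^ 2 = ∑ α, (P α - Tstar α) ^ 2
          - ∑ α, 2 * (w α * (P α - Tstar α)) + ∑ α, (w α) ^ 2 := by
        rw [← Finset.sum_sub_distrib, ← Finset.sum_add_distrib]
        refine Finset.sum_congr rfl fun α _ => ?_
        simp only [Pi.add_apply]; ring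
      have e2 : ∑ α, ((Tstar + w) α - Tstar α) ^ 2 = ∑ α, (w α) ^ 2 := by simp
      linarith
    have hα : Nonempty (Fin k → Fin n) := ⟨fun _ => ⟨0, by omega⟩⟩
    have hGw : 0 ≤ G w := (abs_nonneg _).trans (hG1 w hα.some)
    have h3 : ∑ α, 2 * (w α * (P α - Tstar α)) ≤ ∑ α, 2 * (G w * (|P α| + |Tstar α|)) := by
      refine Finset.sum_le_sum fun α _ => ?_
      have : w α * (P α - Tstar α) ≤ |w α| * |P α - Tstar α| := by
        rw [← abs_mul]; exact le_abs_self _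
      have h5 : |w α| * |P α - Tstar α| ≤ G w * (|P α| + |Tstar α|) :=
        mul_le_mul (hG1 w α) (abs_sub _ _) (abs_nonneg _) hGw
      linarith
    have h4 : ∑ α, 2 * (G w * (|P α| + |Tstar α|)) = 2 * (G w * (∑ α, |P α| + ∑ α, |Tstar α|)) := by
      rw [← Finset.mul_sum, ← Finset.mul_sum, Finset.sum_add_distrib]
    have h6 := l1_bound hk hn ht hP
    have h7 := l1_bound hk hn ht hTm
    have h8 : G w * (∑ α, |P α| + ∑ α, |Tstar α|) ≤ G w * (B + B) := by gcongr
    linarith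
  calc ∫ w, (∑ α, (proj (Tstar + w) α - Tstar α) ^ 2)
            ∂(Measure.pi fun _ : Fin k → Fin n => gaussianReal 0 σ2)
      ≤ ∫ w, 4 * B * G w ∂(Measure.pi fun _ : Fin k → Fin n => gaussianReal 0 σ2) :=
        integral_mono_of_nonneg
          (Filter.Eventually.of_forall fun w => Finset.sum_nonneg fun α _ => sq_nonneg _)
          (hG2.const_mul _) (Filter.Eventually.of_forall key)
    _ = 4 * B * ∫ w, G w ∂(Measure.pi fun _ : Fin k → Fin n => gaussianReal 0 σ2) :=
        integral_const_mul _ _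
    _ ≤ 4 * B * (2 * (2 * Real.sqrt (Real.log (2 / δ)) / (ε * m)) * Real.sqrt (k * Real.log n)) := by
        gcongr
    _ = _ := by rw [hB]; ring
end

section
/- If W is an n×n random matrix with i.i.d. N(0,1) entries, then E ‖W‖ ≤ 2·√n, where ‖W‖ denotes the spectral (operator) norm of W. -/
open MeasureTheory ProbabilityTheory

/-- The spectral (ℓ₂→ℓ₂ operator) norm of a matrix. -/
noncomputable def specNorm {n : ℕ} (M : Matrix (Fin n) (Fin n) ℝ) : ℝ :=
  ‖LinearMap.toContinuousLinearMap (Matrix.toEuclideanLin M)‖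


lemma stein1 (f f' : ℝ → ℝ) (C : ℝ) (hf : ∀ x, HasDerivAt f (f' x) x) (hfb : ∀ x, |f x| ≤ C)
    (hfb' : ∀ x, |f' x| ≤ C) (hc : Continuous f') :
    ∫ x, x * f x ∂(gaussianReal 0 1) = ∫ x, f' x ∂(gaussianReal 0 1) := by
  have hfc : Continuous f := continuous_iff_continuousAt.2 fun x => (hf x).continuousAt
  rw [integral_gaussianReal_eq_integral_smul one_ne_zero,
    integral_gaussianReal_eq_integral_smul one_ne_zero]
  have hpdf : ∀ x, gaussianPDFReal 0 1 x = (Real.sqrt (2 * Real.pi))⁻¹ * Real.exp (-(1/2) * x ^ 2) := by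
    intro x
    simp only [gaussianPDFReal, NNReal.coe_one, mul_one, sub_zero]
    congr 2
    ring
  have hd : ∀ x, HasDerivAt (gaussianPDFReal 0 1) (-(x * gaussianPDFReal 0 1 x)) x := by
    intro x
    have h1 : HasDerivAt (fun x : ℝ => (Real.sqrt (2 * Real.pi))⁻¹ * Real.exp (-(1/2) * x ^ 2))
        ((Real.sqrt (2 * Real.pi))⁻¹ * (Real.exp (-(1/2) * x ^ 2) * (-(1/2) * (2 * x)))) x := by
      have := ((hasDerivAt_pow 2 x).const_mul (-(1/2 : ℝ))).exp.const_mul (Real.sqrt (2 * Real.pi))⁻¹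
      simpa using this
    rw [show gaussianPDFReal 0 1 = _ from funext hpdf]
    convert h1 using 1
    ring
  have hi0 : Integrable (gaussianPDFReal 0 1) := integrable_gaussianPDFReal 0 1
  have hi1 : Integrable (fun x => -(x * gaussianPDFReal 0 1 x)) := by
    have := (integrable_mul_exp_neg_mul_sq (b := 1/2) (by norm_num)).const_mul (Real.sqrt (2 * Real.pi))⁻¹
    refine this.neg.congr (Filter.Eventually.of_forall fun x => ?_)
    simp only [hpdf, Pi.neg_apply]
    ring
  have key := integral_mul_deriv_eq_deriv_mul_of_integrable (u := f) (v := gaussianPDFReal 0 1)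
    (u' := f') (v' := fun x => -(x * gaussianPDFReal 0 1 x)) (fun x _ => hf x) (fun x _ => hd x)
    (hi1.bdd_mul hfc.aestronglyMeasurable (Filter.Eventually.of_forall hfb))
    (hi0.bdd_mul hc.aestronglyMeasurable (Filter.Eventually.of_forall hfb'))
    (hi0.bdd_mul hfc.aestronglyMeasurable (Filter.Eventually.of_forall hfb))
  calc _ = - ∫ x, f x * -(x * gaussianPDFReal 0 1 x) := by
        rw [← integral_neg]; congr 1; ext x; simp only [smul_eq_mul]; ring
    _ = _ := by rw [key, neg_neg]; congr 1; ext x; simp only [smul_eq_mul]; ring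

/-- the standard Gaussian on `ι → ℝ`. -/
noncomputable def gam (ι : Type) [Fintype ι] : Measure (ι → ℝ) :=
  Measure.pi fun _ : ι => gaussianReal 0 1

instance (ι : Type) [Fintype ι] : IsProbabilityMeasure (gam ι) := by
  unfold gam; infer_instance

section
variable {ι : Type} [Fintype ι]

lemma mp_update [DecidableEq ι] (k : ι) :
    MeasurePreserving (fun p : (ι → ℝ) × ℝ => Function.update p.1 k p.2)
      ((gam ι).prod (gaussianReal 0 1)) (gam ι) := by
  have hm : Measurable (fun p : (ι → ℝ) × ℝ => Function.update p.1 k p.2) := by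
    refine measurable_pi_lambda _ fun i => ?_
    by_cases h : i = k
    · subst h; simpa using measurable_snd
    · simp only [Function.update_of_ne h]; fun_prop
  refine ⟨hm, ?_⟩
  unfold gam
  symm
  refine Measure.pi_eq fun s hs => ?_
  rw [Measure.map_apply hm (MeasurableSet.univ_pi hs)]
  have : (fun p : (ι → ℝ) × ℝ => Function.update p.1 k p.2) ⁻¹' (Set.univ.pi s) =
      (Set.univ.pi (Function.update s k Set.univ)) ×ˢ (s k) := by
    ext ⟨x, r⟩
    simp only [Set.mem_preimage, Set.mem_univ_pi, Set.mem_prod]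
    constructor
    · intro h
      refine ⟨fun i => ?_, by simpa using h k⟩
      by_cases hi : i = k
      · subst hi; simp
      · simpa [hi] using h i
    · rintro ⟨h1, h2⟩ i
      by_cases hi : i = k
      · subst hi; simpa using h2
      · simpa [hi] using h1 i
  rw [this, Measure.prod_prod, Measure.pi_pi]
  rw [← Finset.mul_prod_erase _ _ (Finset.mem_univ k), ← Finset.mul_prod_erase _ _ (Finset.mem_univ k)]
  simp only [Function.update_self, measure_univ, one_mul]
  rw [mul_comm]
  congr 1
  refine Finset.prod_congr rfl fun i hi => ?_
  rw [Function.update_of_ne (Finset.ne_of_mem_erase hi)]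

lemma integrable_coord (k : ι) : Integrable (fun x : ι → ℝ => x k) (gam ι) := by
  have h : Integrable (fun x : ℝ => x) (gaussianReal 0 1) :=
    (memLp_id_gaussianReal 1).integrable (by simp)
  exact (measurePreserving_eval (fun _ : ι => gaussianReal 0 1) k).integrable_comp_of_integrable h

lemma sq_coord (k : ι) : Integrable (fun x : ι → ℝ => x k ^ 2) (gam ι) ∧
    ∫ x, x k ^ 2 ∂(gam ι) = 1 := by
  have h : Integrable (fun x : ℝ => x ^ 2) (gaussianReal 0 1) :=
    (memLp_id_gaussianReal 2).integrable_sq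
  have h1 : ∫ x, x ^ 2 ∂(gaussianReal 0 1) = 1 := by
    have := variance_fun_id_gaussianReal (μ := 0) (v := 1)
    rw [variance_of_integral_eq_zero (by fun_prop) (by simp [integral_id_gaussianReal])] at this
    simpa using this
  have mp := measurePreserving_eval (fun _ : ι => gaussianReal 0 1) k
  refine ⟨mp.integrable_comp_of_integrable h, ?_⟩
  rw [← h1, ← mp.map_eq, integral_map mp.measurable.aemeasurable (by fun_prop)]
  rfl

lemma steinPi [DecidableEq ι] (k : ι) (f f' : (ι → ℝ) → ℝ) (C : ℝ) (hfc : Continuous f)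
    (hfc' : Continuous f') (hfb : ∀ x, |f x| ≤ C) (hfb' : ∀ x, |f' x| ≤ C)
    (hf : ∀ x r, HasDerivAt (fun r => f (Function.update x k r)) (f' (Function.update x k r)) r) :
    ∫ x, x k * f x ∂(gam ι) = ∫ x, f' x ∂(gam ι) := by
  have mp := mp_update k
  have i1 : Integrable (fun x : ι → ℝ => x k * f x) (gam ι) :=
    (integrable_coord k).mul_bdd hfc.aestronglyMeasurable (Filter.Eventually.of_forall hfb)
  have i2 : Integrable (fun x : ι → ℝ => f' x) (gam ι) :=
    Integrable.of_bound hfc'.aestronglyMeasurable C (Filter.Eventually.of_forall hfb')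
  have e : ∀ g : (ι → ℝ) → ℝ, Integrable g (gam ι) → ∫ x, g x ∂(gam ι) =
      ∫ x, ∫ r, g (Function.update x k r) ∂(gaussianReal 0 1) ∂(gam ι) := by
    intro g hg
    have h2 := mp.integrable_comp_of_integrable hg
    have h3 := integral_prod _ h2
    simp only [Function.comp] at h3
    rw [← h3]
    conv_lhs => rw [← mp.map_eq]
    rw [integral_map mp.measurable.aemeasurable]
    rw [mp.map_eq]; exact hg.aestronglyMeasurable
  rw [e _ i1, e _ i2]
  congr 1
  ext x
  simp only [Function.update_self]
  refine stein1 (fun r => f (Function.update x k r)) (fun r => f' (Function.update x k r)) C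
    (hf x) (fun r => hfb _) (fun r => hfb' _) ?_
  exact hfc'.comp (by fun_prop)
end

set_option linter.unusedSectionVars false
section
variable {ι N : Type} [Fintype ι] [Fintype N] [Nonempty N]

/-- log-sum-exp -/
noncomputable def lse (y : N → ℝ) : ℝ := Real.log (∑ i, Real.exp (y i))

/-- softmax -/
noncomputable def smx (y : N → ℝ) (i : N) : ℝ := Real.exp (y i) / ∑ j, Real.exp (y j)

/-- linear form -/
def lf (c : N → ι → ℝ) (x : ι → ℝ) (i : N) : ℝ := ∑ k, c i k * x k

lemma sumexp_pos (y : N → ℝ) : 0 < ∑ j, Real.exp (y j) :=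
  Finset.sum_pos (fun _ _ => Real.exp_pos _) Finset.univ_nonempty

lemma smx_nonneg (y : N → ℝ) (i : N) : 0 ≤ smx y i :=
  div_nonneg (Real.exp_pos _).le (sumexp_pos y).le

lemma smx_sum (y : N → ℝ) : ∑ i, smx y i = 1 := by
  unfold smx
  rw [← Finset.sum_div, div_self (sumexp_pos y).ne']

lemma smx_le (y : N → ℝ) (i : N) : smx y i ≤ 1 := by
  rw [← smx_sum y]
  exact Finset.single_le_sum (fun j _ => smx_nonneg y j) (Finset.mem_univ i)

lemma smx_cont (i : N) : Continuous (fun y : N → ℝ => smx y i) := by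
  unfold smx
  exact Continuous.div (by fun_prop) (by fun_prop) fun y => (sumexp_pos y).ne'

lemma lse_cont : Continuous (fun y : N → ℝ => lse y) := by
  unfold lse
  exact Continuous.log (by fun_prop) fun y => (sumexp_pos y).ne'

lemma lf_cont (c : N → ι → ℝ) : Continuous (lf c) := by
  unfold lf
  fun_prop

lemma le_lse (y : N → ℝ) (i : N) : y i ≤ lse y := by
  unfold lse
  rw [Real.le_log_iff_exp_le (sumexp_pos y)]
  exact Finset.single_le_sum (f := fun j => Real.exp (y j)) (fun j _ => (Real.exp_pos _).le)
    (Finset.mem_univ i)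

lemma lse_le (y : N → ℝ) (M : ℝ) (h : ∀ i, y i ≤ M) : lse y ≤ M + Real.log (Fintype.card N) := by
  unfold lse
  have hc : (0 : ℝ) < Fintype.card N := by exact_mod_cast Fintype.card_pos
  rw [Real.log_le_iff_le_exp (sumexp_pos y), Real.exp_add, Real.exp_log hc]
  calc _ ≤ ∑ i : N, Real.exp M := Finset.sum_le_sum fun i _ => Real.exp_le_exp.2 (h i)
    _ = _ := by simp [mul_comm]

lemma lse_deriv (y : ℝ → N → ℝ) (y' : N → ℝ) (t : ℝ)
    (h : ∀ i, HasDerivAt (fun t => y t i) (y' i) t) :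
    HasDerivAt (fun t => lse (y t)) (∑ i, smx (y t) i * y' i) t := by
  unfold lse
  have h1 : HasDerivAt (fun t => ∑ i, Real.exp (y t i)) (∑ i, Real.exp (y t i) * y' i) t :=
    HasDerivAt.fun_sum fun i _ => (h i).exp
  convert h1.log (sumexp_pos _).ne' using 1
  unfold smx
  rw [Finset.sum_div]
  refine Finset.sum_congr rfl fun i _ => ?_
  ring

lemma smx_deriv (y : ℝ → N → ℝ) (y' : N → ℝ) (t : ℝ)
    (h : ∀ i, HasDerivAt (fun t => y t i) (y' i) t) (i : N) :
    HasDerivAt (fun t => smx (y t) i) (smx (y t) i * (y' i - ∑ j, smx (y t) j * y' j)) t := by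
  have e : ∀ z : N → ℝ, smx z i = Real.exp (z i - lse z) := by
    intro z
    rw [Real.exp_sub, lse, Real.exp_log (sumexp_pos z), smx]
  have := ((h i).sub (lse_deriv y y' t h)).exp
  simp only [Pi.sub_apply, ← e] at this
  exact this

lemma lf_update [DecidableEq ι] (c : N → ι → ℝ) (x : ι → ℝ) (k : ι) (r : ℝ) (i : N) :
    HasDerivAt (fun r => lf c (Function.update x k r) i) (c i k) r := by
  have : (fun r => lf c (Function.update x k r) i) =
      fun r => c i k * r + ∑ j ∈ Finset.univ.erase k, c i j * x j := by
    ext r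
    unfold lf
    rw [← Finset.add_sum_erase _ _ (Finset.mem_univ k), Function.update_self]
    congr 1
    refine Finset.sum_congr rfl fun j hj => ?_
    rw [Function.update_of_ne (Finset.ne_of_mem_erase hj)]
  rw [this]
  simpa using ((hasDerivAt_id' r).const_mul (c i k)).add_const
    (∑ j ∈ Finset.univ.erase k, c i j * x j)

lemma stein_smx (c : N → ι → ℝ) (i : N) (k : ι) :
    ∫ x, x k * smx (lf c x) i ∂(gam ι) =
      ∫ x, smx (lf c x) i * (c i k - ∑ j, smx (lf c x) j * c j k) ∂(gam ι) := by
  classical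
  have hs : ∀ i, Continuous fun x => smx (lf c x) i := fun i => (smx_cont i).comp (lf_cont c)
  have hp : ∀ (x : ι → ℝ) i, |smx (lf c x) i| ≤ 1 := fun x i => by
    rw [abs_of_nonneg (smx_nonneg _ _)]; exact smx_le _ _
  refine steinPi k _ _ (1 + (|c i k| + ∑ j, |c j k|)) (hs i) ?_ ?_ ?_ ?_
  · fun_prop
  · intro x
    refine (hp x i).trans ?_
    have : 0 ≤ ∑ j, |c j k| := Finset.sum_nonneg fun _ _ => abs_nonneg _
    linarith [abs_nonneg (c i k)]
  · intro x
    rw [abs_mul]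
    have h1 : |∑ j, smx (lf c x) j * c j k| ≤ ∑ j, |c j k| := by
      refine (Finset.abs_sum_le_sum_abs _ _).trans (Finset.sum_le_sum fun j _ => ?_)
      rw [abs_mul]
      exact mul_le_of_le_one_left (abs_nonneg _) (hp x j)
    have h2 := (abs_sub (c i k) (∑ j, smx (lf c x) j * c j k))
    have h3 := mul_le_of_le_one_left (abs_nonneg (c i k - ∑ j, smx (lf c x) j * c j k)) (hp x i)
    linarith
  · intro x r
    exact smx_deriv (fun r => lf c (Function.update x k r)) (fun j => c j k) r
      (fun j => lf_update c x k r j) i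

lemma lf_bound (c : N → ι → ℝ) (x : ι → ℝ) (i : N) :
    |lf c x i| ≤ ∑ i, ∑ k, |c i k| * |x k| := by
  have h1 : |lf c x i| ≤ ∑ k, |c i k| * |x k| := by
    refine (Finset.abs_sum_le_sum_abs _ _).trans (Finset.sum_le_sum fun j _ => ?_)
    rw [abs_mul]
  refine h1.trans (Finset.single_le_sum (f := fun i => ∑ k, |c i k| * |x k|) (fun j _ => ?_)
    (Finset.mem_univ i))
  positivity

lemma integrable_bd (c : N → ι → ℝ) :
    Integrable (fun x : ι → ℝ => ∑ i, ∑ k, |c i k| * |x k|) (gam ι) :=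
  integrable_finsetSum _ fun i _ => integrable_finsetSum _ fun k _ =>
    (integrable_coord k).abs.const_mul _

lemma integrable_lse (c : N → ι → ℝ) : Integrable (fun x => lse (lf c x)) (gam ι) := by
  refine ((integrable_bd c).add (integrable_const (Real.log (Fintype.card N)))).mono'
    (lse_cont.comp (lf_cont c)).aestronglyMeasurable (Filter.Eventually.of_forall fun x => ?_)
  rw [Real.norm_eq_abs, abs_le]
  have hl : 0 ≤ Real.log (Fintype.card N) := Real.log_natCast_nonneg _
  obtain ⟨i0⟩ := ‹Nonempty N›
  constructor
  · have h1 := le_lse (lf c x) i0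
    have h2 := (abs_le.1 (lf_bound c x i0)).1
    simp only [Pi.add_apply]
    linarith
  · exact lse_le _ _ fun i => (abs_le.1 (lf_bound c x i)).2

lemma quad_nonpos (p : N → ℝ) (hp : ∀ i, 0 ≤ p i) (hs : ∑ i, p i = 1) (D : N → N → ℝ)
    (hD : ∀ i j, D i i + D j j - 2 * D i j ≤ 0) :
    ∑ i, p i * (D i i - ∑ j, p j * D i j) ≤ 0 := by
  have e1 : ∑ i, ∑ j, p i * p j * (D i i + D j j - 2 * D i j) =
      2 * ∑ i, p i * (D i i - ∑ j, p j * D i j) := by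
    have a1 : ∑ i, ∑ j, p i * p j * D i i = ∑ i, p i * D i i := by
      refine Finset.sum_congr rfl fun i _ => ?_
      calc ∑ j, p i * p j * D i i = (∑ j, p j) * (p i * D i i) := by
            rw [Finset.sum_mul]; exact Finset.sum_congr rfl fun j _ => by ring
        _ = _ := by rw [hs, one_mul]
    have a2 : ∑ i, ∑ j, p i * p j * D j j = ∑ i, p i * D i i := by
      rw [Finset.sum_comm, ← a1]
      exact Finset.sum_congr rfl fun i _ => Finset.sum_congr rfl fun j _ => by ring
    have a3 : ∑ i, p i * (D i i - ∑ j, p j * D i j) =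
        ∑ i, p i * D i i - ∑ i, ∑ j, p i * p j * D i j := by
      rw [← Finset.sum_sub_distrib]
      refine Finset.sum_congr rfl fun i _ => ?_
      rw [mul_sub, Finset.mul_sum]
      congr 1
      exact Finset.sum_congr rfl fun j _ => by ring
    rw [a3]
    calc _ = ∑ i, ∑ j, (p i * p j * D i i + p i * p j * D j j - 2 * (p i * p j * D i j)) :=
          Finset.sum_congr rfl fun i _ => Finset.sum_congr rfl fun j _ => by ring
      _ = _ := by
          simp only [Finset.sum_sub_distrib, Finset.sum_add_distrib, ← Finset.mul_sum, a1, a2]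
          ring
  have e2 : ∑ i, ∑ j, p i * p j * (D i i + D j j - 2 * D i j) ≤ 0 :=
    Finset.sum_nonpos fun i _ => Finset.sum_nonpos fun j _ =>
      mul_nonpos_of_nonneg_of_nonpos (mul_nonneg (hp i) (hp j)) (hD i j)
  linarith

/-- interpolating coefficients -/
noncomputable def itp (a b : N → ι → ℝ) (t : ℝ) (i : N) (k : ι) : ℝ :=
  Real.sin t * a i k + Real.cos t * b i k

/-- their derivative -/
noncomputable def itp' (a b : N → ι → ℝ) (t : ℝ) (i : N) (k : ι) : ℝ :=
  Real.cos t * a i k - Real.sin t * b i k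

lemma deriv_itp (a b : N → ι → ℝ) (t : ℝ) :
    HasDerivAt (fun t => ∫ x, lse (lf (itp a b t) x) ∂(gam ι))
      (∫ x, ∑ i, smx (lf (itp a b t) x) i * lf (itp' a b t) x i ∂(gam ι)) t := by
  have hs : ∀ t i, Continuous fun x => smx (lf (itp a b t) x) i :=
    fun t i => (smx_cont i).comp (lf_cont _)
  have hl : ∀ t i, Continuous fun x => lf (itp' a b t) x i :=
    fun t i => (continuous_apply i).comp (lf_cont _)
  refine (hasDerivAt_integral_of_dominated_loc_of_deriv_le (s := Set.univ)
    (bound := fun x => ∑ i, ∑ k, |(|a i k| + |b i k|)| * |x k|)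
    (F' := fun t x => ∑ i, smx (lf (itp a b t) x) i * lf (itp' a b t) x i)
    Filter.univ_mem ?_ (integrable_lse _) ?_ ?_ (integrable_bd fun i k => |a i k| + |b i k|) ?_).2
  · exact Filter.Eventually.of_forall fun t => (lse_cont.comp (lf_cont _)).aestronglyMeasurable
  · apply Continuous.aestronglyMeasurable
    fun_prop
  · refine Filter.Eventually.of_forall fun x t _ => ?_
    rw [Real.norm_eq_abs]
    refine (Finset.abs_sum_le_sum_abs _ _).trans (Finset.sum_le_sum fun i _ => ?_)
    rw [abs_mul, abs_of_nonneg (smx_nonneg _ _)]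
    refine (mul_le_of_le_one_left (abs_nonneg _) (smx_le _ _)).trans ?_
    refine (Finset.abs_sum_le_sum_abs _ _).trans (Finset.sum_le_sum fun k _ => ?_)
    rw [abs_mul]
    refine mul_le_mul_of_nonneg_right ?_ (abs_nonneg _)
    refine le_trans ?_ (le_abs_self _)
    unfold itp'
    refine (abs_sub _ _).trans ?_
    rw [abs_mul, abs_mul]
    exact add_le_add (mul_le_of_le_one_left (abs_nonneg _) (Real.abs_cos_le_one t))
      (mul_le_of_le_one_left (abs_nonneg _) (Real.abs_sin_le_one t))
  · refine Filter.Eventually.of_forall fun x t _ => ?_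
    refine lse_deriv (fun t => lf (itp a b t) x) (lf (itp' a b t) x) t fun i => ?_
    unfold lf
    refine HasDerivAt.fun_sum fun k _ => ?_
    refine HasDerivAt.mul_const ?_ _
    unfold itp itp'
    have := ((Real.hasDerivAt_sin t).mul_const (a i k)).add
      ((Real.hasDerivAt_cos t).mul_const (b i k))
    exact this.congr_deriv (by ring)

lemma deriv_nonpos (a b : N → ι → ℝ) (t : ℝ) (ht : 0 ≤ Real.sin t * Real.cos t)
    (hab : ∀ i j, ∑ k, a i k * b j k = 0)
    (hd : ∀ i j, ∑ k, (a i k - a j k) ^ 2 ≤ ∑ k, (b i k - b j k) ^ 2) :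
    ∫ x, ∑ i, smx (lf (itp a b t) x) i * lf (itp' a b t) x i ∂(gam ι) ≤ 0 := by
  set c := itp a b t with hc
  set c' := itp' a b t with hc'
  have hs : ∀ i, Continuous fun x => smx (lf c x) i := fun i => (smx_cont i).comp (lf_cont c)
  have hp : ∀ (x : ι → ℝ) i, ‖smx (lf c x) i‖ ≤ 1 := fun x i => by
    rw [Real.norm_eq_abs, abs_of_nonneg (smx_nonneg _ _)]; exact smx_le _ _
  have isx : ∀ i, Integrable (fun x => smx (lf c x) i) (gam ι) := fun i =>
    Integrable.of_bound (hs i).aestronglyMeasurable 1 (Filter.Eventually.of_forall fun x => hp x i)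
  have i1 : ∀ i k, Integrable (fun x : ι → ℝ => c' i k * (x k * smx (lf c x) i)) (gam ι) :=
    fun i k => ((integrable_coord k).mul_bdd (hs i).aestronglyMeasurable
      (Filter.Eventually.of_forall fun x => hp x i)).const_mul _
  have i2 : ∀ i k, Integrable (fun x : ι → ℝ => c' i k *
      (smx (lf c x) i * (c i k - ∑ j, smx (lf c x) j * c j k))) (gam ι) := fun i k =>
    (((integrable_const _).sub (integrable_finsetSum _ fun j _ => (isx j).mul_const _)).bdd_mul
      (hs i).aestronglyMeasurable (Filter.Eventually.of_forall fun x => hp x i)).const_mul _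
  have e1 : ∫ x, ∑ i, smx (lf c x) i * lf c' x i ∂(gam ι) =
      ∫ x, ∑ i, ∑ k, c' i k * (smx (lf c x) i * (c i k - ∑ j, smx (lf c x) j * c j k)) ∂(gam ι) := by
    calc _ = ∫ x, ∑ i, ∑ k, c' i k * (x k * smx (lf c x) i) ∂(gam ι) := by
          congr 1; ext x
          refine Finset.sum_congr rfl fun i _ => ?_
          rw [lf, Finset.mul_sum]
          exact Finset.sum_congr rfl fun k _ => by ring
      _ = ∑ i, ∑ k, c' i k * ∫ x, x k * smx (lf c x) i ∂(gam ι) := by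
          rw [integral_finsetSum _ fun i _ => integrable_finsetSum _ fun k _ => i1 i k]
          refine Finset.sum_congr rfl fun i _ => ?_
          rw [integral_finsetSum _ fun k _ => i1 i k]
          exact Finset.sum_congr rfl fun k _ => integral_const_mul _ _
      _ = _ := by
          rw [integral_finsetSum _ fun i _ => integrable_finsetSum _ fun k _ => i2 i k]
          refine Finset.sum_congr rfl fun i _ => ?_
          rw [integral_finsetSum _ fun k _ => i2 i k]
          refine Finset.sum_congr rfl fun k _ => ?_
          rw [stein_smx, integral_const_mul]
  rw [e1]
  refine integral_nonpos fun x => ?_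
  simp only [Pi.zero_apply]
  have hD : ∀ i j, ∑ k, c' i k * c j k =
      (Real.sin t * Real.cos t) * (∑ k, a i k * a j k - ∑ k, b i k * b j k) := by
    intro i j
    have : ∑ k, c' i k * c j k = (Real.sin t * Real.cos t) * (∑ k, a i k * a j k - ∑ k, b i k * b j k)
        + Real.cos t ^ 2 * (∑ k, a i k * b j k) - Real.sin t ^ 2 * (∑ k, a j k * b i k) := by
      simp only [Finset.mul_sum, ← Finset.sum_sub_distrib, ← Finset.sum_add_distrib]
      refine Finset.sum_congr rfl fun k _ => ?_
      simp only [hc, hc', itp, itp']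
      ring
    rw [this, hab, hab]; ring
  have := quad_nonpos (smx (lf c x)) (smx_nonneg _) (smx_sum _) (fun i j => ∑ k, c' i k * c j k)
    (fun i j => by
      simp only [hD]
      have h := hd i j
      have e : ∀ f : N → ι → ℝ, ∑ k, (f i k - f j k) ^ 2 =
          ∑ k, f i k * f i k + ∑ k, f j k * f j k - 2 * ∑ k, f i k * f j k := by
        intro f
        simp only [Finset.mul_sum, ← Finset.sum_sub_distrib, ← Finset.sum_add_distrib]
        exact Finset.sum_congr rfl fun k _ => by ring
      rw [e, e] at h
      nlinarith [mul_nonneg ht (sub_nonneg.2 h)])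
  refine le_of_eq_of_le ?_ this
  refine Finset.sum_congr rfl fun i _ => ?_
  calc _ = smx (lf c x) i * (∑ k, c' i k * c i k - ∑ k, ∑ j, smx (lf c x) j * (c' i k * c j k)) := by
        rw [← Finset.sum_sub_distrib, Finset.mul_sum]
        refine Finset.sum_congr rfl fun k _ => ?_
        rw [mul_left_comm, mul_sub, Finset.mul_sum]
        congr 2
        exact Finset.sum_congr rfl fun j _ => by ring
    _ = _ := by
        rw [Finset.sum_comm]
        simp only [Finset.mul_sum]

/-- Sudakov–Fernique, smoothed form. -/
lemma sudakov (a b : N → ι → ℝ)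
    (hab : ∀ i j, ∑ k, a i k * b j k = 0)
    (hd : ∀ i j, ∑ k, (a i k - a j k) ^ 2 ≤ ∑ k, (b i k - b j k) ^ 2) :
    ∫ x, lse (lf a x) ∂(gam ι) ≤ ∫ x, lse (lf b x) ∂(gam ι) := by
  have hpi := Real.pi_pos
  have := antitoneOn_of_deriv_nonpos (convex_Icc 0 (Real.pi / 2))
    (f := fun t => ∫ x, lse (lf (itp a b t) x) ∂(gam ι))
    (fun t _ => (deriv_itp a b t).continuousAt.continuousWithinAt)
    (fun t _ => (deriv_itp a b t).differentiableAt.differentiableWithinAt)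
    (fun t ht => by
      rw [interior_Icc] at ht
      rw [(deriv_itp a b t).deriv]
      refine deriv_nonpos a b t (mul_nonneg ?_ ?_) hab hd
      · exact Real.sin_nonneg_of_nonneg_of_le_pi ht.1.le (by linarith [ht.2])
      · exact Real.cos_nonneg_of_neg_pi_div_two_le_of_le (by linarith [ht.1]) ht.2.le)
  have h := this (Set.left_mem_Icc.2 (by positivity)) (Set.right_mem_Icc.2 (by positivity))
    (by positivity)
  simp only [] at h
  rw [show itp a b 0 = b by ext; simp [itp], show itp a b (Real.pi / 2) = a by ext; simp [itp]] at h
  exact h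
end

section

/-- index type: matrix entries plus two vectors. -/
abbrev Ix (n : ℕ) : Type := (Fin n × Fin n) ⊕ (Fin n ⊕ Fin n)

lemma mp_mat (n : ℕ) : MeasurePreserving (fun (x : Ix n → ℝ) (i j : Fin n) => x (Sum.inl (i, j)))
    (gam (Ix n)) (matGaussian n 1) := by
  have h1 := measurePreserving_sumPiEquivProdPi (X := fun _ : Ix n => ℝ)
    (fun _ : Ix n => gaussianReal 0 1)
  have h2 := (measurePreserving_fst (μ := Measure.pi fun _ : Fin n × Fin n => gaussianReal 0 1)
    (ν := Measure.pi fun _ : Fin n ⊕ Fin n => gaussianReal 0 1)).comp h1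
  have h3 : MeasurePreserving (MeasurableEquiv.curry (Fin n) (Fin n) ℝ)
      (Measure.pi fun _ : Fin n × Fin n => gaussianReal 0 1) (matGaussian n 1) := by
    refine ⟨MeasurableEquiv.measurable _, ?_⟩
    have := Measure.infinitePi_map_curry (fun _ _ : Fin n => gaussianReal 0 1)
    simpa only [Measure.infinitePi_eq_pi, matGaussian] using this
  exact h3.comp h2

lemma integral_norm_le (n : ℕ) (e : Fin n → Ix n) :
    Integrable (fun x : Ix n → ℝ => Real.sqrt (∑ i, x (e i) ^ 2)) (gam (Ix n)) ∧
    ∫ x, Real.sqrt (∑ i, x (e i) ^ 2) ∂(gam (Ix n)) ≤ Real.sqrt n := by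
  have hc : Continuous (fun x : Ix n → ℝ => Real.sqrt (∑ i, x (e i) ^ 2)) := by fun_prop
  have hi : Integrable (fun x : Ix n → ℝ => ∑ i, x (e i) ^ 2) (gam (Ix n)) :=
    integrable_finsetSum _ fun i _ => (sq_coord (e i)).1
  have hL : MemLp (fun x : Ix n → ℝ => Real.sqrt (∑ i, x (e i) ^ 2)) 2 (gam (Ix n)) := by
    rw [memLp_two_iff_integrable_sq hc.aestronglyMeasurable]
    refine hi.congr (Filter.Eventually.of_forall fun x => ?_)
    simp only
    rw [Real.sq_sqrt (Finset.sum_nonneg fun _ _ => sq_nonneg _)]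
  refine ⟨hL.integrable (by simp), ?_⟩
  have hv := variance_nonneg (fun x : Ix n → ℝ => Real.sqrt (∑ i, x (e i) ^ 2)) (gam (Ix n))
  rw [variance_eq_sub hL] at hv
  refine Real.le_sqrt_of_sq_le ?_
  have : ∫ x : Ix n → ℝ, ((fun x : Ix n → ℝ => Real.sqrt (∑ i, x (e i) ^ 2)) ^ 2) x ∂(gam (Ix n)) = n := by
    calc _ = ∫ x : Ix n → ℝ, ∑ i, x (e i) ^ 2 ∂(gam (Ix n)) := by
          congr 1; ext x
          simp only [Pi.pow_apply]
          rw [Real.sq_sqrt (Finset.sum_nonneg fun _ _ => sq_nonneg _)]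
      _ = _ := by
          rw [integral_finsetSum _ fun i _ => (sq_coord (e i)).1]
          simp [(sq_coord (e _)).2]
  rw [this] at hv
  linarith

lemma net_bound (n : ℕ) (S : Finset (EuclideanSpace ℝ (Fin n))) (ε : ℝ)
    (hS1 : ∀ u ∈ S, ‖u‖ = 1)
    (hS : ∀ u : EuclideanSpace ℝ (Fin n), ‖u‖ = 1 → ∃ u' ∈ S, ‖u - u'‖ ≤ ε)
    (hne : S.Nonempty) (hε : 0 ≤ ε)
    (w : Fin n → Fin n → ℝ) (M : ℝ)
    (hM : ∀ u ∈ S, ∀ v ∈ S, ∑ p : Fin n × Fin n, u p.1 * v p.2 * w p.1 p.2 ≤ M) :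
    (1 - 2 * ε) * specNorm (Matrix.of w) ≤ M := by
  set T := LinearMap.toContinuousLinearMap (Matrix.toEuclideanLin (Matrix.of w)) with hT
  have hin : ∀ u v : EuclideanSpace ℝ (Fin n), inner ℝ u (T v) =
      ∑ p : Fin n × Fin n, u p.1 * v p.2 * w p.1 p.2 := by
    intro u v
    rw [Fintype.sum_prod_type]
    simp only [hT, LinearMap.coe_toContinuousLinearMap', PiLp.inner_apply, Matrix.toLpLin_apply,
      Matrix.mulVec, dotProduct, Matrix.of_apply, RCLike.inner_apply, conj_trivial, Finset.sum_mul]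
    exact Finset.sum_congr rfl fun i _ => Finset.sum_congr rfl fun j _ => by ring
  have claim : ∀ v, ‖v‖ = 1 → T v ≠ 0 → ‖T v‖ ≤ M + 2 * ε * ‖T‖ := by
    intro v hv h0
    have hn : ‖T v‖ ≠ 0 := norm_ne_zero_iff.2 h0
    set u := (‖T v‖⁻¹ : ℝ) • T v with hu
    have hu1 : ‖u‖ = 1 := by
      rw [hu, norm_smul, norm_inv, norm_norm, inv_mul_cancel₀ hn]
    obtain ⟨v', hv', hvd⟩ := hS v hv
    obtain ⟨u', hu', hud⟩ := hS u hu1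
    have e1 : inner ℝ u (T v) = ‖T v‖ := by
      rw [hu, inner_smul_left, real_inner_self_eq_norm_sq]
      simp; field_simp
    have e2 : inner ℝ u (T v) = inner ℝ u' (T v') + inner ℝ (u - u') (T v) + inner ℝ u' (T (v - v')) := by
      rw [inner_sub_left, map_sub, inner_sub_right]; ring
    have b1 := hM u' hu' v' hv'
    rw [← hin] at b1
    have b2 : inner ℝ (u - u') (T v) ≤ ε * ‖T‖ := by
      refine (real_inner_le_norm _ _).trans ?_
      refine mul_le_mul hud ?_ (norm_nonneg _) hε
      simpa [hv] using T.le_opNorm v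
    have b3 : inner ℝ u' (T (v - v')) ≤ ε * ‖T‖ := by
      refine (real_inner_le_norm _ _).trans ?_
      rw [hS1 u' hu', one_mul, mul_comm]
      exact (T.le_opNorm _).trans (mul_le_mul_of_nonneg_left hvd (norm_nonneg _))
    rw [← e1, e2]
    linarith
  have hpos : 0 ≤ M + 2 * ε * ‖T‖ := by
    obtain ⟨u0, hu0⟩ := hne
    by_cases h0 : T u0 = 0
    · have b1 := hM u0 hu0 u0 hu0
      rw [← hin, h0, inner_zero_right] at b1
      positivity
    · exact (norm_nonneg _).trans (claim u0 (hS1 u0 hu0) h0)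
  have key : ‖T‖ ≤ M + 2 * ε * ‖T‖ := by
    refine ContinuousLinearMap.opNorm_le_of_unit_norm hpos fun v hv => ?_
    by_cases h0 : T v = 0
    · rw [h0, norm_zero]; exact hpos
    · exact claim v hv h0
  change (1 - 2 * ε) * ‖T‖ ≤ M
  linarith

lemma exists_net (n : ℕ) (hn : 0 < n) (ε : ℝ) (hε : 0 < ε) :
    ∃ S : Finset (EuclideanSpace ℝ (Fin n)), S.Nonempty ∧ (∀ u ∈ S, ‖u‖ = 1) ∧
      ∀ u : EuclideanSpace ℝ (Fin n), ‖u‖ = 1 → ∃ u' ∈ S, ‖u - u'‖ ≤ ε := by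
  obtain ⟨t, ht, hf, hc⟩ := (isCompact_sphere (0 : EuclideanSpace ℝ (Fin n)) 1).finite_cover_balls hε
  have hcov : ∀ u : EuclideanSpace ℝ (Fin n), ‖u‖ = 1 → ∃ u' ∈ hf.toFinset, ‖u - u'‖ ≤ ε := by
    intro u hu
    have := hc (show u ∈ Metric.sphere 0 1 by simpa using hu)
    simp only [Set.mem_iUnion] at this
    obtain ⟨u', h1, h2⟩ := this
    refine ⟨u', by simpa using h1, ?_⟩
    rw [← dist_eq_norm]; exact (Metric.mem_ball.1 h2).le
  refine ⟨hf.toFinset, ?_, ?_, hcov⟩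
  · obtain ⟨u', h, _⟩ := hcov (EuclideanSpace.single ⟨0, hn⟩ 1) (by simp)
    exact ⟨u', h⟩
  · intro u hu
    have := ht (by simpa using hu)
    simpa using this

lemma cs (n : ℕ) (u : EuclideanSpace ℝ (Fin n)) (hu : ‖u‖ = 1) (g : Fin n → ℝ) :
    ∑ i, u i * g i ≤ Real.sqrt (∑ i, g i ^ 2) := by
  have h := real_inner_le_norm u (WithLp.toLp 2 g)
  rw [hu, one_mul, EuclideanSpace.norm_eq, PiLp.inner_apply] at h
  simpa [mul_comm] using h

lemma net_expect (n : ℕ) (S : Finset (EuclideanSpace ℝ (Fin n))) (ε : ℝ)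
    (hS1 : ∀ u ∈ S, ‖u‖ = 1)
    (hS : ∀ u : EuclideanSpace ℝ (Fin n), ‖u‖ = 1 → ∃ u' ∈ S, ‖u - u'‖ ≤ ε)
    (hne : S.Nonempty) (hε : 0 ≤ ε) (β : ℝ) (hβ : 0 < β)
    (hint : Integrable (fun w => specNorm (Matrix.of w)) (matGaussian n 1)) :
    (1 - 2 * ε) * ∫ w, specNorm (Matrix.of w) ∂(matGaussian n 1) ≤
      2 * Real.sqrt n + Real.log (Fintype.card (S × S)) / β := by
  obtain ⟨u0, hu0⟩ := hne
  have : Nonempty (S × S) := ⟨(⟨u0, hu0⟩, ⟨u0, hu0⟩)⟩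
  set a : S × S → Ix n → ℝ := fun q => Sum.elim (fun p => β * (q.1.1 p.1 * q.2.1 p.2)) (fun _ => 0)
    with ha
  set b : S × S → Ix n → ℝ := fun q => Sum.elim (fun _ => 0)
    (Sum.elim (fun i => β * q.1.1 i) (fun i => β * q.2.1 i)) with hb
  have hsq : ∀ q : S, ∑ i, q.1 i ^ 2 = 1 := by
    intro q
    have := EuclideanSpace.real_norm_sq_eq q.1
    rw [hS1 q.1 q.2] at this
    rw [← this]; norm_num
  have hle : ∀ q r : S, ∑ i, q.1 i * r.1 i ≤ 1 := by
    intro q r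
    have := cs n q.1 (hS1 q.1 q.2) (fun i => r.1 i)
    rwa [hsq r, Real.sqrt_one] at this
  have hSF := sudakov a b
    (by intro i j; simp [ha, hb, Fintype.sum_sum_type])
    (by
      intro q r
      have ea : ∑ k, (a q k - a r k) ^ 2 = β ^ 2 * (2 - 2 * ((∑ i, q.1.1 i * r.1.1 i) *
          (∑ i, q.2.1 i * r.2.1 i))) := by
        have h1 : (2 : ℝ) = (∑ i, q.1.1 i ^ 2) * (∑ i, q.2.1 i ^ 2) +
          (∑ i, r.1.1 i ^ 2) * (∑ i, r.2.1 i ^ 2) := by simp only [hsq]; norm_num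
        simp only [ha, Fintype.sum_sum_type, Sum.elim_inl, Sum.elim_inr, sub_self]
        conv_rhs => rw [sub_eq_add_neg]; enter [2, 1]; rw [h1]
        simp only [Finset.sum_mul_sum, Fintype.sum_prod_type, ← sub_eq_add_neg]
        simp only [Finset.mul_sum,
          ← Finset.sum_add_distrib, ← Finset.sum_sub_distrib]
        simp only [ne_eq, OfNat.ofNat_ne_zero, not_false_eq_true, zero_pow, Finset.sum_const_zero,
          add_zero]
        exact Finset.sum_congr rfl fun i _ => Finset.sum_congr rfl fun j _ => by ring
      have ev : ∀ q r : S, ∑ i, (β * q.1 i - β * r.1 i) ^ 2 =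
          β ^ 2 * (2 - 2 * ∑ i, q.1 i * r.1 i) := by
        intro q r
        have h1 : (2 : ℝ) = (∑ i, q.1 i ^ 2) + (∑ i, r.1 i ^ 2) := by simp only [hsq]; norm_num
        conv_rhs => rw [sub_eq_add_neg]; enter [2, 1]; rw [h1]
        simp only [← sub_eq_add_neg, Finset.mul_sum,
          ← Finset.sum_add_distrib, ← Finset.sum_sub_distrib]
        exact Finset.sum_congr rfl fun i _ => by ring
      have eb : ∑ k, (b q k - b r k) ^ 2 = β ^ 2 * (2 - 2 * ∑ i, q.1.1 i * r.1.1 i) +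
          β ^ 2 * (2 - 2 * ∑ i, q.2.1 i * r.2.1 i) := by
        rw [← ev, ← ev]
        simp [hb, Fintype.sum_sum_type]
      rw [ea, eb]
      have h1 := sub_nonneg.2 (hle q.1 r.1)
      have h2 := sub_nonneg.2 (hle q.2 r.2)
      nlinarith [mul_nonneg (sq_nonneg β) (mul_nonneg h1 h2)])
  have mp := mp_mat n
  have hint' := mp.integrable_comp_of_integrable hint
  have hI : ∫ w, specNorm (Matrix.of w) ∂(matGaussian n 1) =
      ∫ x : Ix n → ℝ, specNorm (Matrix.of fun i j => x (Sum.inl (i, j))) ∂(gam (Ix n)) := by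
    conv_lhs => rw [← mp.map_eq]
    rw [integral_map mp.measurable.aemeasurable]
    rw [mp.map_eq]; exact hint.aestronglyMeasurable
  have lower : β * ((1 - 2 * ε) * ∫ w, specNorm (Matrix.of w) ∂(matGaussian n 1)) ≤
      ∫ x, lse (lf a x) ∂(gam (Ix n)) := by
    rw [hI, ← integral_const_mul, ← integral_const_mul]
    refine integral_mono ((hint'.const_mul _).const_mul _) (integrable_lse a) fun x => ?_
    simp only
    rw [mul_comm, ← le_div_iff₀ hβ]
    refine net_bound n S ε hS1 hS ⟨u0, hu0⟩ hε _ _ fun u hu v hv => ?_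
    rw [le_div_iff₀ hβ]
    refine le_of_eq_of_le ?_ (le_lse (lf a x) (⟨u, hu⟩, ⟨v, hv⟩))
    simp only [lf, ha, Fintype.sum_sum_type, Sum.elim_inl, Sum.elim_inr, zero_mul,
      Finset.sum_const_zero, add_zero, Finset.sum_mul]
    exact Finset.sum_congr rfl fun p _ => by ring
  obtain ⟨g1, g2⟩ := integral_norm_le n (fun i => Sum.inr (Sum.inl i))
  obtain ⟨k1, k2⟩ := integral_norm_le n (fun i => Sum.inr (Sum.inr i))
  have upper : ∫ x, lse (lf b x) ∂(gam (Ix n)) ≤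
      β * (2 * Real.sqrt n) + Real.log (Fintype.card (S × S)) := by
    have hb1 : ∀ x : Ix n → ℝ, lse (lf b x) ≤ β * (Real.sqrt (∑ i, x (Sum.inr (Sum.inl i)) ^ 2) +
        Real.sqrt (∑ i, x (Sum.inr (Sum.inr i)) ^ 2)) + Real.log (Fintype.card (S × S)) := by
      intro x
      refine lse_le _ _ fun q => ?_
      have c1 := cs n q.1.1 (hS1 _ q.1.2) (fun i => x (Sum.inr (Sum.inl i)))
      have c2 := cs n q.2.1 (hS1 _ q.2.2) (fun i => x (Sum.inr (Sum.inr i)))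
      have := mul_le_mul_of_nonneg_left (add_le_add c1 c2) hβ.le
      refine le_of_eq_of_le ?_ this
      simp [lf, hb, Fintype.sum_sum_type, mul_add, Finset.mul_sum, mul_assoc]
    refine (integral_mono (integrable_lse b)
      (((g1.add k1).const_mul β).add (integrable_const _)) hb1).trans ?_
    rw [integral_add' ((g1.add k1).const_mul β) (integrable_const _), integral_const_mul,
      integral_add' g1 k1, integral_const]
    simp only [probReal_univ, one_smul]
    have := mul_le_mul_of_nonneg_left (add_le_add g2 k2) hβ.le
    linarith
  have fin := lower.trans (hSF.trans upper)
  rw [← sub_le_iff_le_add', le_div_iff₀ hβ]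
  linarith
end

/-- if `W` is an `n×n` random matrix with i.i.d. `N(0,1)` entries, then
`E ‖W‖ ≤ 2·√n` for the spectral norm. -/
theorem expected_spectral_norm_gaussian_matrix (n : ℕ) :
    ∫ w, specNorm (Matrix.of w) ∂(matGaussian n 1) ≤ 2 * Real.sqrt n := by
  by_cases hint : Integrable (fun w => specNorm (Matrix.of w)) (matGaussian n 1)
  swap
  · rw [integral_undef hint]; positivity
  rcases Nat.eq_zero_or_pos n with rfl | hn
  · have : ∀ w : Fin 0 → Fin 0 → ℝ, specNorm (Matrix.of w) = 0 := by
      intro w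
      unfold specNorm
      rw [norm_eq_zero]
      ext v i
      exact i.elim0
    simp [this]
  set I := ∫ w, specNorm (Matrix.of w) ∂(matGaussian n 1) with hIdef
  have hI0 : 0 ≤ I := integral_nonneg fun w => norm_nonneg _
  have step : ∀ ε : ℝ, 0 < ε → (1 - 2 * ε) * I ≤ 2 * Real.sqrt n := by
    intro ε hε
    obtain ⟨S, hne, hS1, hS⟩ := exists_net n hn ε hε
    refine le_of_forall_pos_le_add fun δ hδ => ?_
    set K := Real.log (Fintype.card (S × S)) with hK
    have hK0 : 0 ≤ K := Real.log_natCast_nonneg _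
    have hβ : 0 < (K + 1) / δ := by positivity
    refine (net_expect n S ε hS1 hS hne hε.le ((K + 1) / δ) hβ hint).trans ?_
    rw [← hK]
    gcongr
    rw [div_le_iff₀ hβ]
    field_simp
    linarith
  refine le_of_forall_pos_le_add fun δ hδ => ?_
  have h := step (δ / (2 * (I + 1))) (by positivity)
  have h2 : 2 * (δ / (2 * (I + 1))) * I ≤ δ := by
    rw [show 2 * (δ / (2 * (I + 1))) * I = δ * I / (I + 1) by field_simp]
    rw [div_le_iff₀ (by positivity)]
    nlinarith
  linarith
end
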